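/- Let γ = 4/15 + Σ_{a=2}^∞ Σ_{1 ≤ b < a, gcd(a,b)=1} 2(3+(−1)^{a+b}) f(a,b), where f(a,b) = (20a^6 + 25a^5 b − 7a^4 b^2 + 28a^3 b^3 − 20a^2 b^4 + 3ab^5 − b^6)/(240 a^5 (a+b)^2 (a^2+b^2)). Then there exist a constant C > 0 and N ∈ ℕ such that for all n ≥ N, the number T(n) of isosceles trapezia with vertices in [n]^2 satisfies |T(n) − γ n^5| ≤ C · n^4 · log n. -/

import Mathlib

/-- The grid `[n]^2`: points of `ℝ^2` with both coordinates integers in `{1, …, n}`. -/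
def grid (n : ℕ) : Set (EuclideanSpace ℝ (Fin 2)) :=
  {x | ∀ i, ∃ m : ℕ, 1 ≤ m ∧ m ≤ n ∧ x i = (m : ℝ)}

/-- The rational function `f(a,b)` from the definition of `γ`. -/
noncomputable def fab (a b : ℕ) : ℝ :=
  (20 * (a : ℝ) ^ 6 + 25 * (a : ℝ) ^ 5 * (b : ℝ) - 7 * (a : ℝ) ^ 4 * (b : ℝ) ^ 2
      + 28 * (a : ℝ) ^ 3 * (b : ℝ) ^ 3 - 20 * (a : ℝ) ^ 2 * (b : ℝ) ^ 4
      + 3 * (a : ℝ) * (b : ℝ) ^ 5 - (b : ℝ) ^ 6) /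
    (240 * (a : ℝ) ^ 5 * ((a : ℝ) + (b : ℝ)) ^ 2 * ((a : ℝ) ^ 2 + (b : ℝ) ^ 2))

/-- The constant `γ = 4/15 + Σ_{a≥2} Σ_{1 ≤ b < a, gcd(a,b)=1} 2(3+(−1)^{a+b}) f(a,b)`.
(The summands with `a < 2` are empty sums, so the outer sum may run over all of `ℕ`.) -/
noncomputable def gammaConst : ℝ :=
  4 / 15 + ∑' a : ℕ, ∑ b ∈ (Finset.Ico 1 a).filter (fun b => Nat.gcd a b = 1),
    2 * (3 + (-1 : ℝ) ^ (a + b)) * fab a b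

/-- `φ` is the reflection of `ℝ^2` across some line: it is an isometry of `ℝ^2` whose
fixed-point set is a line (a one-dimensional affine subspace). -/
def IsLineReflection
    (φ : EuclideanSpace ℝ (Fin 2) ≃ᵃⁱ[ℝ] EuclideanSpace ℝ (Fin 2)) : Prop :=
  ∃ L : AffineSubspace ℝ (EuclideanSpace ℝ (Fin 2)),
    Module.finrank ℝ L.direction = 1 ∧ ∀ x, φ x = x ↔ x ∈ L

/-- An isosceles trapezium: a 4-element subset of `ℝ^2` lying on a common circle which is
mapped to itself by the reflection of `ℝ^2` across some line. -/
def IsIsoscelesTrapezium (Q : Set (EuclideanSpace ℝ (Fin 2))) : Prop :=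
  Q.ncard = 4 ∧ (∃ (c : EuclideanSpace ℝ (Fin 2)) (ρ : ℝ), 0 < ρ ∧ Q ⊆ Metric.sphere c ρ) ∧
  ∃ φ : EuclideanSpace ℝ (Fin 2) ≃ᵃⁱ[ℝ] EuclideanSpace ℝ (Fin 2),
    IsLineReflection φ ∧ φ '' Q = Q

/-- `T(n)`: the number of isosceles trapezia with vertices in `[n]^2`. -/
noncomputable def trapeziumCount (n : ℕ) : ℕ :=
  {Q : Set (EuclideanSpace ℝ (Fin 2)) | Q ⊆ grid n ∧ IsIsoscelesTrapezium Q}.ncard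

namespace ITrap
open MeasureTheory intervalIntegral

/-- the one-dimensional comparison of a sum with an integral for antitone functions -/
lemma riem1 (g : ℝ → ℝ) (hg : Antitone g) (h0 : ∀ x, 0 ≤ g x) (hB : g 0 ≤ 1)
    (hs : ∀ x, 1 ≤ x → g x = 0) (h : ℝ) (hh : 0 < h) (M : ℕ) (hM : 1 ≤ h * M)
    (θ : ℝ) (hθ0 : 0 ≤ θ) (hθ1 : θ ≤ 1) :
    |h * ∑ m ∈ Finset.range M, g (h * (m + θ)) - ∫ x in (0:ℝ)..1, g x| ≤ h := by
  have hii : ∀ a b : ℝ, IntervalIntegrable g volume a b := fun a b => hg.intervalIntegrable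
  have hG : Antitone (fun x : ℝ => g (h * x)) := fun x y hxy =>
    hg (mul_le_mul_of_nonneg_left hxy hh.le)
  have e1 : ∫ x in (0:ℝ)..1, g x = ∫ x in (0:ℝ)..(h * M), g x := by
    rw [← integral_add_adjacent_intervals (hii 0 1) (hii 1 (h * M))]
    have : ∫ x in (1:ℝ)..(h * M), g x = ∫ x in (1:ℝ)..(h * M), (0:ℝ) := by
      apply integral_congr
      intro x hx
      rw [Set.uIcc_of_le hM] at hx
      exact hs x hx.1
    rw [this]; simp
  have e2 : ∫ x in (0:ℝ)..(h * M), g x = h * ∫ x in (0:ℝ)..(0 + (M:ℝ)), g (h * x) := by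
    rw [integral_comp_mul_left g hh.ne']
    simp [hh.ne']
  have l1 := AntitoneOn.integral_le_sum (x₀ := 0) (a := M) (hG.antitoneOn _)
  have l2 := AntitoneOn.sum_le_integral (x₀ := 0) (a := M) (hG.antitoneOn _)
  simp only [zero_add] at l1 l2 e2
  have u1 : ∑ m ∈ Finset.range M, g (h * (m + θ)) ≤ ∑ m ∈ Finset.range M, g (h * m) :=
    Finset.sum_le_sum fun m _ => hg (by nlinarith)
  have u2 : ∑ m ∈ Finset.range M, g (h * ((m + 1 : ℕ) : ℝ)) ≤
      ∑ m ∈ Finset.range M, g (h * (m + θ)) :=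
    Finset.sum_le_sum fun m _ => hg (by push_cast; nlinarith)
  have u3 : ∑ m ∈ Finset.range M, g (h * m) ≤
      ∑ m ∈ Finset.range M, g (h * ((m + 1 : ℕ) : ℝ)) + 1 := by
    have := Finset.sum_range_succ (fun m : ℕ => g (h * m)) M
    have h2 := Finset.sum_range_succ' (fun m : ℕ => g (h * m)) M
    have h3 := h0 (h * M)
    simp only [Nat.cast_zero, mul_zero] at h2
    linarith
  rw [e1, e2, abs_le]
  constructor <;> nlinarith

/-- three-dimensional version -/
lemma riem3 (F : ℝ → ℝ → ℝ → ℝ)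
    (hx : ∀ y z, Antitone fun x => F x y z) (hy : ∀ x z, Antitone fun y => F x y z)
    (hz : ∀ x y, Antitone fun z => F x y z) (h0 : ∀ x y z, 0 ≤ F x y z)
    (hB : F 0 0 0 ≤ 1)
    (sx : ∀ x y z, 1 ≤ x → 0 ≤ y → 0 ≤ z → F x y z = 0)
    (sy : ∀ x y z, 0 ≤ x → 1 ≤ y → 0 ≤ z → F x y z = 0)
    (sz : ∀ x y z, 0 ≤ x → 0 ≤ y → 1 ≤ z → F x y z = 0)
    (h : ℝ) (hh : 0 < h) (M : ℕ) (hM : 1 ≤ h * M) (hM2 : h * M ≤ 2)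
    (θ₁ θ₂ θ₃ : ℝ) (h10 : 0 ≤ θ₁) (h11 : θ₁ ≤ 1) (h20 : 0 ≤ θ₂) (h21 : θ₂ ≤ 1)
    (h30 : 0 ≤ θ₃) (h31 : θ₃ ≤ 1) :
    |h ^ 3 * ∑ i ∈ Finset.range M, ∑ j ∈ Finset.range M, ∑ k ∈ Finset.range M,
        F (h * (i + θ₁)) (h * (j + θ₂)) (h * (k + θ₃))
      - ∫ x in (0:ℝ)..1, ∫ y in (0:ℝ)..1, ∫ z in (0:ℝ)..1, F x y z| ≤ 7 * h := by
  have hB' : ∀ x y z, 0 ≤ x → 0 ≤ y → 0 ≤ z → F x y z ≤ 1 := fun x y z ax ay az =>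
    (hx y z ax).trans ((hy 0 z ay).trans ((hz 0 0 az).trans hB))
  have iz : ∀ x y, IntervalIntegrable (fun z => F x y z) volume 0 1 :=
    fun x y => (hz x y).intervalIntegrable
  set G : ℝ → ℝ → ℝ := fun x y => ∫ z in (0:ℝ)..1, F x y z with hGdef
  have Gx : ∀ y, Antitone fun x => G x y := fun y a b hab =>
    integral_mono_on zero_le_one (iz _ _) (iz _ _) fun z _ => hx y z hab
  have Gy : ∀ x, Antitone fun y => G x y := fun x a b hab =>
    integral_mono_on zero_le_one (iz _ _) (iz _ _) fun z _ => hy x z hab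
  have G0 : ∀ x y, 0 ≤ G x y := fun x y =>
    integral_nonneg zero_le_one fun z _ => h0 x y z
  have GB : ∀ x y, 0 ≤ x → 0 ≤ y → G x y ≤ 1 := fun x y ax ay => by
    have : G x y ≤ ∫ z in (0:ℝ)..1, (1:ℝ) :=
      integral_mono_on zero_le_one (iz _ _) (by simp) fun z hz => hB' x y z ax ay hz.1
    simpa using this
  have Gz1 : ∀ x y, 1 ≤ x → 0 ≤ y → G x y = 0 := fun x y ax ay => by
    have : G x y = ∫ z in (0:ℝ)..1, (0:ℝ) := by
      apply integral_congr
      intro z hz; rw [Set.uIcc_of_le zero_le_one] at hz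
      exact sx x y z ax ay hz.1
    simpa using this
  have Gz2 : ∀ x y, 0 ≤ x → 1 ≤ y → G x y = 0 := fun x y ax ay => by
    have : G x y = ∫ z in (0:ℝ)..1, (0:ℝ) := by
      apply integral_congr
      intro z hz; rw [Set.uIcc_of_le zero_le_one] at hz
      exact sy x y z ax ay hz.1
    simpa using this
  have iy : ∀ x, IntervalIntegrable (fun y => G x y) volume 0 1 :=
    fun x => (Gy x).intervalIntegrable
  set H : ℝ → ℝ := fun x => ∫ y in (0:ℝ)..1, G x y with hHdef
  have Hx : Antitone H := fun a b hab =>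
    integral_mono_on zero_le_one (iy _) (iy _) fun y _ => Gx y hab
  have H0 : ∀ x, 0 ≤ H x := fun x => integral_nonneg zero_le_one fun z _ => G0 x z
  have HB : H 0 ≤ 1 := by
    have : H 0 ≤ ∫ z in (0:ℝ)..1, (1:ℝ) :=
      integral_mono_on zero_le_one (iy _) (by simp) fun z hz => GB 0 z le_rfl hz.1
    simpa using this
  have Hz : ∀ x, 1 ≤ x → H x = 0 := fun x ax => by
    have : H x = ∫ z in (0:ℝ)..1, (0:ℝ) := by
      apply integral_congr
      intro z hz; rw [Set.uIcc_of_le zero_le_one] at hz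
      exact Gz1 x z ax hz.1
    simpa using this
  have M0 : (0:ℝ) ≤ M := Nat.cast_nonneg M
  have s3 := riem1 H Hx H0 HB Hz h hh M hM θ₁ h10 h11
  have s2 : ∀ i : ℕ, |h * ∑ j ∈ Finset.range M, G (h * (i + θ₁)) (h * (j + θ₂))
      - H (h * (i + θ₁))| ≤ h := fun i =>
    riem1 _ (Gy _) (fun _ => G0 _ _) (GB _ _ (by positivity) le_rfl)
      (fun y ay => Gz2 _ _ (by positivity) ay) h hh M hM θ₂ h20 h21
  have s1 : ∀ i j : ℕ, |h * ∑ k ∈ Finset.range M,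
      F (h * (i + θ₁)) (h * (j + θ₂)) (h * (k + θ₃))
      - G (h * (i + θ₁)) (h * (j + θ₂))| ≤ h := fun i j =>
    riem1 _ (hz _ _) (fun _ => h0 _ _ _) (hB' _ _ _ (by positivity) (by positivity) le_rfl)
      (fun y ay => sz _ _ _ (by positivity) (by positivity) ay) h hh M hM θ₃ h30 h31
  have t2 : |h * ∑ i ∈ Finset.range M, (h * ∑ j ∈ Finset.range M, G (h * (i + θ₁)) (h * (j + θ₂))
      - H (h * (i + θ₁)))| ≤ h * (M * h) := by
    rw [abs_mul, abs_of_pos hh]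
    gcongr
    refine (Finset.abs_sum_le_sum_abs _ _).trans ?_
    refine (Finset.sum_le_sum fun i _ => s2 i).trans ?_
    simp
  have t1 : |h * ∑ i ∈ Finset.range M, (h * ∑ j ∈ Finset.range M, (h * ∑ k ∈ Finset.range M,
      F (h * (i + θ₁)) (h * (j + θ₂)) (h * (k + θ₃))
      - G (h * (i + θ₁)) (h * (j + θ₂))))| ≤ h * (M * (h * (M * h))) := by
    rw [abs_mul, abs_of_pos hh]
    gcongr
    refine (Finset.abs_sum_le_sum_abs _ _).trans ?_
    refine (Finset.sum_le_sum (g := fun _ => h * (M * h)) fun i _ => ?_).trans ?_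
    · rw [abs_mul, abs_of_pos hh]
      gcongr
      refine (Finset.abs_sum_le_sum_abs _ _).trans ?_
      refine (Finset.sum_le_sum fun j _ => s1 i j).trans ?_
      simp
    · simp
  have b2 : h * (M * h) ≤ 2 * h := by nlinarith
  have b1 : h * (M * (h * (M * h))) ≤ 4 * h := by nlinarith
  have key : h ^ 3 * ∑ i ∈ Finset.range M, ∑ j ∈ Finset.range M, ∑ k ∈ Finset.range M,
        F (h * (i + θ₁)) (h * (j + θ₂)) (h * (k + θ₃)) - ∫ x in (0:ℝ)..1, H x =
      (h * ∑ i ∈ Finset.range M, (h * ∑ j ∈ Finset.range M, (h * ∑ k ∈ Finset.range M,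
      F (h * (i + θ₁)) (h * (j + θ₂)) (h * (k + θ₃))
      - G (h * (i + θ₁)) (h * (j + θ₂))))) +
      (h * ∑ i ∈ Finset.range M, (h * ∑ j ∈ Finset.range M, G (h * (i + θ₁)) (h * (j + θ₂))
      - H (h * (i + θ₁)))) +
      (h * ∑ m ∈ Finset.range M, H (h * (m + θ₁)) - ∫ x in (0:ℝ)..1, H x) := by
    simp only [Finset.sum_sub_distrib, ← Finset.mul_sum, mul_sub]
    ring
  change |_ - ∫ x in (0:ℝ)..1, H x| ≤ _
  rw [key]
  refine (abs_add_le _ _).trans ?_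
  refine (add_le_add (abs_add_le _ _) le_rfl).trans ?_
  linarith

end ITrap

namespace ITrap
open MeasureTheory intervalIntegral

/-- polynomial functions of degree at most `k` -/
def PolyLE (k : ℕ) (f : ℝ → ℝ) : Prop :=
  ∃ c : ℕ → ℝ, ∀ x, f x = ∑ i ∈ Finset.range (k + 1), c i * x ^ i

lemma PolyLE.of (k : ℕ) (f : ℝ → ℝ) (p : Polynomial ℝ) (hp : p.natDegree ≤ k)
    (h : ∀ x, f x = p.eval x) : PolyLE k f :=
  ⟨p.coeff, fun x => by
    rw [h, Polynomial.eval_eq_sum_range' (Nat.lt_succ_of_le hp)]⟩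

lemma PolyLE.exists {k : ℕ} {f : ℝ → ℝ} (h : PolyLE k f) :
    ∃ p : Polynomial ℝ, p.natDegree ≤ k ∧ ∀ x, f x = p.eval x := by
  obtain ⟨c, hc⟩ := h
  refine ⟨∑ i ∈ Finset.range (k + 1), Polynomial.C (c i) * Polynomial.X ^ i, ?_, ?_⟩
  · apply Polynomial.natDegree_sum_le_of_forall_le
    intro i hi
    refine (Polynomial.natDegree_C_mul_X_pow_le _ _).trans ?_
    simp at hi; omega
  · intro x
    rw [hc, Polynomial.eval_finset_sum]
    simp

lemma PolyLE.lin (a b : ℝ) : PolyLE 1 (fun x => a + b * x) :=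
  ⟨fun i => if i = 0 then a else b, fun x => by simp [Finset.sum_range_succ]⟩

lemma PolyLE.lin' (f : ℝ → ℝ) (a b : ℝ) (h : ∀ x, f x = a + b * x) : PolyLE 1 f := by
  have : f = fun x => a + b * x := funext h
  rw [this]; exact PolyLE.lin a b

lemma PolyLE.mul {k l : ℕ} {f g : ℝ → ℝ} (hf : PolyLE k f) (hg : PolyLE l g) :
    PolyLE (k + l) (fun x => f x * g x) := by
  obtain ⟨p, hp, hp'⟩ := hf.exists
  obtain ⟨q, hq, hq'⟩ := hg.exists
  exact PolyLE.of _ _ (p * q) (Polynomial.natDegree_mul_le.trans (add_le_add hp hq))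
    fun x => by simp [hp', hq']

lemma PolyLE.add {k : ℕ} {f g : ℝ → ℝ} (hf : PolyLE k f) (hg : PolyLE k g) :
    PolyLE k (fun x => f x + g x) := by
  obtain ⟨c, hc⟩ := hf
  obtain ⟨d, hd⟩ := hg
  exact ⟨fun i => c i + d i, fun x => by simp [hc, hd, add_mul, Finset.sum_add_distrib]⟩

lemma PolyLE.cmul {k : ℕ} {f : ℝ → ℝ} (a : ℝ) (hf : PolyLE k f) :
    PolyLE k (fun x => a * f x) := by
  obtain ⟨c, hc⟩ := hf
  exact ⟨fun i => a * c i, fun x => by simp [hc, Finset.mul_sum, mul_assoc]⟩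

/-- Boole rule is exact in degree at most four -/
lemma boole {f g : ℝ → ℝ} (hg : PolyLE 4 g) {a b : ℝ} (hab : a ≤ b)
    (h : ∀ x, a ≤ x → x ≤ b → f x = g x) :
    ∫ x in a..b, f x = (b - a) / 90 * (7 * g a + 32 * g ((3 * a + b) / 4)
      + 12 * g ((a + b) / 2) + 32 * g ((a + 3 * b) / 4) + 7 * g b) := by
  have e : ∫ x in a..b, f x = ∫ x in a..b, g x := by
    apply integral_congr
    intro x hx; rw [Set.uIcc_of_le hab] at hx
    exact h x hx.1 hx.2
  obtain ⟨c, hc⟩ := hg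
  have hd : ∀ x ∈ Set.uIcc a b, HasDerivAt (fun x : ℝ => c 0 * x + c 1 / 2 * x ^ 2 + c 2 / 3 * x ^ 3
      + c 3 / 4 * x ^ 4 + c 4 / 5 * x ^ 5) (g x) x := by
    intro x _
    have d1 := (hasDerivAt_id x).const_mul (c 0)
    have d2 := (hasDerivAt_pow 2 x).const_mul (c 1 / 2)
    have d3 := (hasDerivAt_pow 3 x).const_mul (c 2 / 3)
    have d4 := (hasDerivAt_pow 4 x).const_mul (c 3 / 4)
    have d5 := (hasDerivAt_pow 5 x).const_mul (c 4 / 5)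
    refine ((((d1.add d2).add d3).add d4).add d5).congr_deriv ?_
    rw [hc]; simp [Finset.sum_range_succ]; ring
  have hcont : Continuous g := by
    have : g = fun x => ∑ i ∈ Finset.range (4 + 1), c i * x ^ i := funext hc
    rw [this]; fun_prop
  rw [e, integral_eq_sub_of_hasDerivAt hd (hcont.intervalIntegrable _ _)]
  simp only [hc, Finset.sum_range_succ, Finset.sum_range_zero]
  ring

/-- Simpson rule is exact in degree at most three -/
lemma simpson {f g : ℝ → ℝ} (hg : PolyLE 3 g) {a b : ℝ} (hab : a ≤ b)
    (h : ∀ x, a ≤ x → x ≤ b → f x = g x) :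
    ∫ x in a..b, f x = (b - a) / 6 * (g a + 4 * g ((a + b) / 2) + g b) := by
  have h4 : PolyLE 4 g := by
    obtain ⟨p, hp, hp'⟩ := hg.exists
    exact PolyLE.of _ _ p (hp.trans (by norm_num)) hp'
  rw [boole h4 hab h]
  obtain ⟨c, hc⟩ := hg
  simp only [hc, Finset.sum_range_succ, Finset.sum_range_zero]
  ring

lemma integral_zero_on {f : ℝ → ℝ} {a b : ℝ} (hab : a ≤ b)
    (h : ∀ x, a ≤ x → x ≤ b → f x = 0) : ∫ x in a..b, f x = 0 := by
  have e : ∫ x in a..b, f x = ∫ x in a..b, (0:ℝ) := by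
    apply integral_congr
    intro x hx; rw [Set.uIcc_of_le hab] at hx
    exact h x hx.1 hx.2
  rw [e]; simp

/-- the inner integral -/
noncomputable def Phi (r P Q : ℝ) : ℝ := ∫ v in (0:ℝ)..1, max 0 (P - v) * max 0 (Q - r * v)

lemma Phi_ii (r P Q : ℝ) (a b : ℝ) :
    IntervalIntegrable (fun v => max 0 (P - v) * max 0 (Q - r * v)) volume a b := by
  apply Continuous.intervalIntegrable
  fun_prop

lemma Phi_P (r P Q : ℝ) (hP : P ≤ 0) : Phi r P Q = 0 :=
  integral_zero_on zero_le_one fun v h0 _ => by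
    rw [max_eq_left (by linarith), zero_mul]

lemma Phi_Q (r P Q : ℝ) (hr : 0 ≤ r) (hQ : Q ≤ 0) : Phi r P Q = 0 :=
  integral_zero_on zero_le_one fun v h0 _ => by
    rw [max_eq_left (b := Q - r * v) (by nlinarith), mul_zero]

lemma Phi_aux (r P Q s : ℝ) (s0 : 0 ≤ s) (s1 : s ≤ 1)
    (h1 : ∀ v, 0 ≤ v → v ≤ s → 0 ≤ P - v ∧ 0 ≤ Q - r * v)
    (h2 : ∀ v, s ≤ v → v ≤ 1 → P - v ≤ 0 ∨ Q - r * v ≤ 0) :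
    Phi r P Q = s / 6 * (P * Q + 4 * ((P - s / 2) * (Q - r * s / 2)) + (P - s) * (Q - r * s)) := by
  unfold Phi
  rw [← integral_add_adjacent_intervals (Phi_ii r P Q 0 s) (Phi_ii r P Q s 1)]
  rw [integral_zero_on s1 (fun v hv hv1 => by
    rcases h2 v hv hv1 with h | h
    · rw [max_eq_left h, zero_mul]
    · rw [max_eq_left h, mul_zero])]
  have pl : PolyLE 3 (fun v => (P - v) * (Q - r * v)) := 
    ⟨fun i => if i = 0 then P * Q else if i = 1 then - Q - P * r else if i = 2 then r else 0,
      fun x => by simp [Finset.sum_range_succ]; ring⟩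
  rw [simpson pl s0 (fun v hv hv1 => by
    rw [max_eq_right (h1 v hv hv1).1, max_eq_right (h1 v hv hv1).2])]
  ring

lemma Phi_1 (r P Q : ℝ) (hr : 0 ≤ r) (hP : 0 ≤ P) (hP1 : P ≤ 1) (h : r * P ≤ Q) :
    Phi r P Q = P * P * ((1 / 2) * Q + (- r / 6) * P) := by
  rw [Phi_aux r P Q P hP hP1 (fun v h0 h1 => ⟨by linarith, by nlinarith⟩)
    (fun v h0 h1 => Or.inl (by linarith))]
  ring

lemma Phi_2 (r P Q : ℝ) (hr : 0 < r) (hQ : 0 ≤ Q) (hP1 : P ≤ 1) (h : Q ≤ r * P) :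
    Phi r P Q = Q * Q * ((1 / (2 * r)) * P + (- 1 / (6 * r ^ 2)) * Q) := by
  have hq : Q / r ≤ P := by rw [div_le_iff₀ hr]; linarith
  have e : r * (Q / r) = Q := by field_simp
  rw [Phi_aux r P Q (Q / r) (by positivity) (hq.trans hP1)
    (fun v h0 h1 => ⟨by linarith, by nlinarith⟩)
    (fun v h0 h1 => Or.inr (by nlinarith))]
  field_simp
  ring

/-- the normalized summand -/
noncomputable def FF (r x y z : ℝ) : ℝ :=
  max 0 (1 - z - x - max x (r * y)) * max 0 (1 - r * z - r * x - max (r * x) y)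

lemma FF_z (r x y : ℝ) : ∫ z in (0:ℝ)..1, FF r x y z =
    Phi r (1 - x - max x (r * y)) (1 - r * x - max (r * x) y) := by
  unfold Phi FF
  congr 1; ext v; congr 2 <;> ring_nf

lemma FF_nonneg (r x y z : ℝ) : 0 ≤ FF r x y z := by unfold FF; positivity

lemma FF_anti_x (r : ℝ) (hr : 0 ≤ r) (y z : ℝ) : Antitone fun x => FF r x y z := by
  intro a b hab
  unfold FF
  dsimp only
  gcongr

lemma FF_anti_y (r : ℝ) (hr : 0 ≤ r) (x z : ℝ) : Antitone fun y => FF r x y z := by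
  intro a b hab
  unfold FF
  dsimp only
  gcongr

lemma FF_anti_z (r : ℝ) (hr : 0 ≤ r) (x y : ℝ) : Antitone fun z => FF r x y z := by
  intro a b hab
  unfold FF
  dsimp only
  gcongr

lemma FF_0 (r : ℝ) : FF r 0 0 0 ≤ 1 := by
  unfold FF; simp

lemma FF_sx (r : ℝ) (x y z : ℝ) (hx : 1 ≤ x) (hy : 0 ≤ y) (hz : 0 ≤ z) :
    FF r x y z = 0 := by
  unfold FF
  have := le_max_left x (r * y)
  rw [max_eq_left (by linarith), zero_mul]

lemma FF_sy (r : ℝ) (hr : 0 ≤ r) (x y z : ℝ) (hx : 0 ≤ x) (hy : 1 ≤ y) (hz : 0 ≤ z) :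
    FF r x y z = 0 := by
  unfold FF
  have := le_max_right (r * x) y
  have h1 := mul_nonneg hr hx
  have h2 := mul_nonneg hr hz
  rw [max_eq_left (b := 1 - r * z - r * x - max (r * x) y) (by linarith), mul_zero]

lemma FF_sz (r : ℝ) (x y z : ℝ) (hx : 0 ≤ x) (hy : 0 ≤ y) (hz : 1 ≤ z) :
    FF r x y z = 0 := by
  unfold FF
  have := le_max_left x (r * y)
  rw [max_eq_left (by linarith), zero_mul]

lemma FF_yint (r : ℝ) (hr : 0 ≤ r) (x a b : ℝ) :
    IntervalIntegrable (fun y => ∫ z in (0:ℝ)..1, FF r x y z) volume a b := by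
  apply Antitone.intervalIntegrable
  intro p q hpq
  exact integral_mono_on zero_le_one (FF_anti_z r hr _ _).intervalIntegrable
    (FF_anti_z r hr _ _).intervalIntegrable fun z _ => FF_anti_y r hr x z hpq

lemma FF_xint (r : ℝ) (hr : 0 ≤ r) (a b : ℝ) :
    IntervalIntegrable (fun x => ∫ y in (0:ℝ)..1, ∫ z in (0:ℝ)..1, FF r x y z) volume a b := by
  apply Antitone.intervalIntegrable
  intro p q hpq
  exact integral_mono_on zero_le_one (FF_yint r hr _ _ _) (FF_yint r hr _ _ _)
    fun y _ => integral_mono_on zero_le_one (FF_anti_z r hr _ _).intervalIntegrable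
    (FF_anti_z r hr _ _).intervalIntegrable fun z _ => FF_anti_x r hr y z hpq

end ITrap

namespace ITrap
open MeasureTheory intervalIntegral

/-- cubic building block -/
noncomputable def pc (c d p0 p1 p2 q0 q1 q2 x y : ℝ) : ℝ :=
  (p0 + p1 * x + p2 * y) * (p0 + p1 * x + p2 * y) *
    (c * (q0 + q1 * x + q2 * y) + d * (p0 + p1 * x + p2 * y))

/-- its integral over `y` from `a0 + a1 x` to `b0 + b1 x` -/
noncomputable def ps (c d p0 p1 p2 q0 q1 q2 a0 a1 b0 b1 x : ℝ) : ℝ :=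
  ((b0 + b1 * x) - (a0 + a1 * x)) / 6 * (pc c d p0 p1 p2 q0 q1 q2 x (a0 + a1 * x)
    + 4 * pc c d p0 p1 p2 q0 q1 q2 x (((a0 + a1 * x) + (b0 + b1 * x)) / 2)
    + pc c d p0 p1 p2 q0 q1 q2 x (b0 + b1 * x))

lemma pc_poly_y (c d p0 p1 p2 q0 q1 q2 x : ℝ) :
    PolyLE 3 (fun y => pc c d p0 p1 p2 q0 q1 q2 x y) := by
  have hP : PolyLE 1 (fun y => p0 + p1 * x + p2 * y) := PolyLE.lin _ _
  have hQ : PolyLE 1 (fun y => q0 + q1 * x + q2 * y) := PolyLE.lin _ _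
  exact (hP.mul hP).mul ((hQ.cmul c).add (hP.cmul d))

lemma pc_poly_x (c d p0 p1 p2 q0 q1 q2 s t : ℝ) (g : ℝ → ℝ) (hg : ∀ x, g x = s + t * x) :
    PolyLE 3 (fun x => pc c d p0 p1 p2 q0 q1 q2 x (g x)) := by
  have hP : PolyLE 1 (fun x => p0 + p1 * x + p2 * g x) :=
    PolyLE.lin' _ (p0 + p2 * s) (p1 + p2 * t) fun x => by rw [hg]; ring
  have hQ : PolyLE 1 (fun x => q0 + q1 * x + q2 * g x) :=
    PolyLE.lin' _ (q0 + q2 * s) (q1 + q2 * t) fun x => by rw [hg]; ring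
  exact (hP.mul hP).mul ((hQ.cmul c).add (hP.cmul d))

lemma ps_poly (c d p0 p1 p2 q0 q1 q2 a0 a1 b0 b1 : ℝ) :
    PolyLE 4 (fun x => ps c d p0 p1 p2 q0 q1 q2 a0 a1 b0 b1 x) := by
  have h0 : PolyLE 1 (fun x => ((b0 + b1 * x) - (a0 + a1 * x)) / 6) :=
    PolyLE.lin' _ ((b0 - a0) / 6) ((b1 - a1) / 6) fun x => by ring
  have h1 := pc_poly_x c d p0 p1 p2 q0 q1 q2 a0 a1 (fun x => a0 + a1 * x) fun x => rfl
  have h2 := pc_poly_x c d p0 p1 p2 q0 q1 q2 ((a0 + b0) / 2) ((a1 + b1) / 2)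
    (fun x => ((a0 + a1 * x) + (b0 + b1 * x)) / 2) fun x => by ring
  have h3 := pc_poly_x c d p0 p1 p2 q0 q1 q2 b0 b1 (fun x => b0 + b1 * x) fun x => rfl
  exact h0.mul ((h1.add (h2.cmul 4)).add h3)

lemma ps_int (c d p0 p1 p2 q0 q1 q2 a0 a1 b0 b1 x : ℝ) (f : ℝ → ℝ) (a b : ℝ)
    (ha : a = a0 + a1 * x) (hb : b = b0 + b1 * x)
    (hab : a ≤ b) (h : ∀ y, a ≤ y → y ≤ b → f y = pc c d p0 p1 p2 q0 q1 q2 x y) :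
    ∫ y in a..b, f y = ps c d p0 p1 p2 q0 q1 q2 a0 a1 b0 b1 x := by
  rw [simpson (pc_poly_y c d p0 p1 p2 q0 q1 q2 x) hab h, ha, hb]
  rfl

/-- the integral over `y` -/
noncomputable def HH (r x : ℝ) : ℝ := ∫ y in (0:ℝ)..1, ∫ z in (0:ℝ)..1, FF r x y z

lemma HH_half (r x : ℝ) (hx : 1 / 2 ≤ x) : HH r x = 0 :=
  integral_zero_on zero_le_one fun y _ _ => by
    rw [FF_z, Phi_P]
    have := le_max_left x (r * y)
    linarith

lemma piece1 (r x : ℝ) (hr : 0 < r) (hr1 : r ≤ 1) (hx0 : 0 ≤ x) (hx : x ≤ 1 / 2) :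
    ∫ y in (0:ℝ)..(r * x), ∫ z in (0:ℝ)..1, FF r x y z =
      ps (1/2) (-r/6) 1 (-2) 0 1 (-2*r) 0 0 0 0 r x := by
  apply ps_int _ _ _ _ _ _ _ _ _ _ _ _ _ _ _ _ (by ring) (by ring) (by positivity)
  intro y h0 h1
  rw [FF_z, max_eq_left (by nlinarith), max_eq_left h1, Phi_1 r _ _ hr.le (by linarith)
    (by linarith) (by nlinarith)]
  unfold pc; ring

lemma piece2 (r x : ℝ) (hr : 0 < r) (hr1 : r ≤ 1) (hx0 : 0 ≤ x) (hx : x ≤ 1 / 2)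
    (b b0 b1 : ℝ) (hb : b = b0 + b1 * x) (h1 : b ≤ x / r) (h2 : b ≤ 1 - r + r * x)
    (h3 : r * x ≤ b) :
    ∫ y in (r * x)..b, ∫ z in (0:ℝ)..1, FF r x y z =
      ps (1/2) (-r/6) 1 (-2) 0 1 (-r) (-1) 0 r b0 b1 x := by
  apply ps_int _ _ _ _ _ _ _ _ _ _ _ _ _ _ _ _ (by ring) hb h3
  intro y hy0 hy1
  have : r * y ≤ x := by
    have := hy1.trans h1
    rw [le_div_iff₀ hr] at this; linarith
  rw [FF_z, max_eq_left this, max_eq_right hy0, Phi_1 r _ _ hr.le (by linarith)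
    (by linarith) (by nlinarith)]
  unfold pc; ring

lemma piece3 (r x : ℝ) (hr : 0 < r) (hr1 : r ≤ 1) (hx0 : 0 ≤ x) (hx : x ≤ r / (1 + r)) :
    ∫ y in (x / r)..(1 / (1 + r)), ∫ z in (0:ℝ)..1, FF r x y z =
      ps (1/2) (-r/6) 1 (-1) (-r) 1 (-r) (-1) 0 (1/r) (1/(1+r)) 0 x := by
  have hx' : x * (1 + r) ≤ r := by rwa [le_div_iff₀ (by linarith)] at hx
  apply ps_int _ _ _ _ _ _ _ _ _ _ _ _ _ _ _ _ (by ring) (by ring)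
  · rw [div_le_div_iff₀ hr (by linarith)]; linarith
  intro y hy0 hy1
  rw [div_le_iff₀ hr] at hy0
  rw [le_div_iff₀ (by linarith)] at hy1
  have hy : 0 ≤ y := by nlinarith
  have e1 : x ≤ r * y := by linarith
  have e2 : r * x ≤ y := by nlinarith
  have e3 : 0 ≤ 1 - x - r * y := by nlinarith
  rw [FF_z, max_eq_right e1, max_eq_right e2, Phi_1 r _ _ hr.le e3
    (by nlinarith) (by nlinarith)]
  unfold pc; ring

lemma piece4 (r x : ℝ) (hr : 0 < r) (hr1 : r ≤ 1) (hx0 : 0 ≤ x) (hx : x ≤ 1 / (1 + r))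
    (a a0 a1 : ℝ) (ha : a = a0 + a1 * x) (h1 : x / r ≤ a) (h2 : 1 / (1 + r) ≤ a)
    (h3 : a ≤ 1 - r * x) :
    ∫ y in a..(1 - r * x), ∫ z in (0:ℝ)..1, FF r x y z =
      ps (1/(2*r)) (-1/(6*r^2)) 1 (-r) (-1) 1 (-1) (-r) a0 a1 1 (-r) x := by
  have hx' : x * (1 + r) ≤ 1 := by rwa [le_div_iff₀ (by linarith)] at hx
  apply ps_int _ _ _ _ _ _ _ _ _ _ _ _ _ _ _ _ ha (by ring) h3
  intro y hy0 hy1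
  have hy2 := h1.trans hy0
  have hy3 := h2.trans hy0
  rw [div_le_iff₀ hr] at hy2
  rw [div_le_iff₀ (by linarith)] at hy3
  have hy : 0 ≤ y := by nlinarith
  have e1 : x ≤ r * y := by linarith
  have e2 : r * x ≤ y := by nlinarith
  rw [FF_z, max_eq_right e1, max_eq_right e2, Phi_2 r _ _ hr (by linarith)
    (by nlinarith) (by nlinarith)]
  unfold pc; ring

lemma piece5 (r x : ℝ) (hr : 0 < r) (hr1 : r ≤ 1) (hx0 : 0 ≤ x) (hx : x ≤ 1 / 2)
    (b b0 b1 : ℝ) (hb : b = b0 + b1 * x) (h1 : b ≤ x / r) (h2 : b ≤ 1 - r * x)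
    (h3 : 1 - r + r * x ≤ b) :
    ∫ y in (1 - r + r * x)..b, ∫ z in (0:ℝ)..1, FF r x y z =
      ps (1/(2*r)) (-1/(6*r^2)) 1 (-r) (-1) 1 (-2) 0 (1-r) r b0 b1 x := by
  apply ps_int _ _ _ _ _ _ _ _ _ _ _ _ _ _ _ _ (by ring) hb h3
  intro y hy0 hy1
  have : r * y ≤ x := by
    have := hy1.trans h1
    rw [le_div_iff₀ hr] at this; linarith
  rw [FF_z, max_eq_left this, max_eq_right (by linarith), Phi_2 r _ _ hr (by linarith)
    (by linarith) (by nlinarith)]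
  unfold pc; ring

lemma piece0 (r x : ℝ) (hr : 0 < r) (hx0 : 0 ≤ x) :
    ∫ y in (1 - r * x)..1, ∫ z in (0:ℝ)..1, FF r x y z = 0 := by
  apply integral_zero_on (by nlinarith)
  intro y h0 _
  rw [FF_z, Phi_Q _ _ _ hr.le]
  have := le_max_right (r * x) y
  linarith

/-- first range -/
noncomputable def HA (r x : ℝ) : ℝ :=
  ps (1/2) (-r/6) 1 (-2) 0 1 (-2*r) 0 0 0 0 r x +
  ps (1/2) (-r/6) 1 (-2) 0 1 (-r) (-1) 0 r 0 (1/r) x +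
  ps (1/2) (-r/6) 1 (-1) (-r) 1 (-r) (-1) 0 (1/r) (1/(1+r)) 0 x +
  ps (1/(2*r)) (-1/(6*r^2)) 1 (-r) (-1) 1 (-1) (-r) (1/(1+r)) 0 1 (-r) x

/-- second range -/
noncomputable def HB (r x : ℝ) : ℝ :=
  ps (1/2) (-r/6) 1 (-2) 0 1 (-2*r) 0 0 0 0 r x +
  ps (1/2) (-r/6) 1 (-2) 0 1 (-r) (-1) 0 r (1-r) r x +
  ps (1/(2*r)) (-1/(6*r^2)) 1 (-r) (-1) 1 (-2) 0 (1-r) r 0 (1/r) x +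
  ps (1/(2*r)) (-1/(6*r^2)) 1 (-r) (-1) 1 (-1) (-r) 0 (1/r) 1 (-r) x

/-- third range -/
noncomputable def HC (r x : ℝ) : ℝ :=
  ps (1/2) (-r/6) 1 (-2) 0 1 (-2*r) 0 0 0 0 r x +
  ps (1/2) (-r/6) 1 (-2) 0 1 (-r) (-1) 0 r (1-r) r x +
  ps (1/(2*r)) (-1/(6*r^2)) 1 (-r) (-1) 1 (-2) 0 (1-r) r 1 (-r) x

lemma HH_A (r x : ℝ) (hr : 0 < r) (hr1 : r ≤ 1) (hx0 : 0 ≤ x) (hx : x ≤ r / (1 + r)) :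
    HH r x = HA r x := by
  have hx' : x * (1 + r) ≤ r := by rwa [le_div_iff₀ (by linarith)] at hx
  have hq : r * (1 / (1 + r)) = 1 - 1 / (1 + r) := by field_simp; ring
  have hq' : r / (1 + r) = 1 - 1 / (1 + r) := by field_simp; ring
  have hp : 0 < 1 / (1 + r) := by positivity
  have k1 : x / r ≤ 1 / (1 + r) := by rw [div_le_div_iff₀ hr (by linarith)]; linarith
  have k2 : 1 / 2 ≤ 1 / (1 + r) := by gcongr; linarith
  have k3 : r * x ≤ x / r := by rw [le_div_iff₀ hr]; nlinarith
  have k4 : x / r ≤ 1 - r + r * x := by rw [div_le_iff₀ hr]; nlinarith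
  have ii := FF_yint r hr.le x
  unfold HH HA
  rw [← integral_add_adjacent_intervals (ii 0 (1 - r * x)) (ii _ _), piece0 r x hr hx0,
    ← integral_add_adjacent_intervals (ii 0 (1 / (1 + r))) (ii _ _),
    ← integral_add_adjacent_intervals (ii 0 (x / r)) (ii _ _),
    ← integral_add_adjacent_intervals (ii 0 (r * x)) (ii _ _),
    piece1 r x hr hr1 hx0 (by linarith), piece3 r x hr hr1 hx0 hx,
    piece2 r x hr hr1 hx0 (by linarith) _ 0 (1/r) (by ring) le_rfl k4 k3,
    piece4 r x hr hr1 hx0 (by linarith) _ (1/(1+r)) 0 (by ring) k1 le_rfl (by nlinarith)]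
  ring

lemma HH_B (r x : ℝ) (hr : 0 < r) (hr1 : r ≤ 1) (hx0 : r / (1 + r) ≤ x)
    (hx : x ≤ r / (1 + r ^ 2)) :
    HH r x = HB r x := by
  have h0 : 0 ≤ x := le_trans (by positivity) hx0
  have hx1 : r ≤ x * (1 + r) := by rwa [div_le_iff₀ (by linarith)] at hx0
  have hx2 : x * (1 + r ^ 2) ≤ r := by rwa [le_div_iff₀ (by positivity)] at hx
  have hh : x ≤ 1 / 2 := by nlinarith [sq_nonneg (1 - r)]
  have ht : x ≤ 1 / (1 + r) := by rw [le_div_iff₀ (by linarith)]; nlinarith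
  have k1 : x / r ≤ 1 - r * x := by rw [div_le_iff₀ hr]; nlinarith
  have k2 : 1 / (1 + r) ≤ x / r := by rw [div_le_div_iff₀ (by linarith) hr]; linarith
  have k3 : 1 - r + r * x ≤ x / r := by rw [le_div_iff₀ hr]; nlinarith
  have ii := FF_yint r hr.le x
  unfold HH HB
  rw [← integral_add_adjacent_intervals (ii 0 (1 - r * x)) (ii _ _), piece0 r x hr h0,
    ← integral_add_adjacent_intervals (ii 0 (x / r)) (ii _ _),
    ← integral_add_adjacent_intervals (ii 0 (1 - r + r * x)) (ii _ _),
    ← integral_add_adjacent_intervals (ii 0 (r * x)) (ii _ _),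
    piece1 r x hr hr1 h0 hh,
    piece2 r x hr hr1 h0 hh _ (1-r) r (by ring) k3 le_rfl (by linarith),
    piece5 r x hr hr1 h0 hh _ 0 (1/r) (by ring) le_rfl k1 k3,
    piece4 r x hr hr1 h0 ht _ 0 (1/r) (by ring) le_rfl k2 k1]
  ring

lemma HH_C (r x : ℝ) (hr : 0 < r) (hr1 : r ≤ 1) (hx0 : r / (1 + r ^ 2) ≤ x)
    (hx : x ≤ 1 / 2) :
    HH r x = HC r x := by
  have h0 : 0 ≤ x := le_trans (by positivity) hx0
  have hx1 : r ≤ x * (1 + r ^ 2) := by rwa [div_le_iff₀ (by positivity)] at hx0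
  have k1 : 1 - r * x ≤ x / r := by rw [le_div_iff₀ hr]; nlinarith
  have k3 : 1 - r + r * x ≤ 1 - r * x := by nlinarith
  have ii := FF_yint r hr.le x
  unfold HH HC
  rw [← integral_add_adjacent_intervals (ii 0 (1 - r * x)) (ii _ _), piece0 r x hr h0,
    ← integral_add_adjacent_intervals (ii 0 (1 - r + r * x)) (ii _ _),
    ← integral_add_adjacent_intervals (ii 0 (r * x)) (ii _ _),
    piece1 r x hr hr1 h0 hx,
    piece2 r x hr hr1 h0 hx _ (1-r) r (by ring) (k3.trans k1) le_rfl (by linarith),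
    piece5 r x hr hr1 h0 hx _ 1 (-r) (by ring) k1 le_rfl k3]
  ring

/-- the value of the triple integral -/
noncomputable def KK (r : ℝ) : ℝ :=
  (20 + 25 * r - 7 * r ^ 2 + 28 * r ^ 3 - 20 * r ^ 4 + 3 * r ^ 5 - r ^ 6) /
    (480 * (1 + r) ^ 2 * (1 + r ^ 2))

end ITrap

namespace ITrap
open MeasureTheory intervalIntegral

/-- Boole rule -/
noncomputable def bl (g : ℝ → ℝ) (a b : ℝ) : ℝ :=
  (b - a) / 90 * (7 * g a + 32 * g ((3 * a + b) / 4)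
      + 12 * g ((a + b) / 2) + 32 * g ((a + 3 * b) / 4) + 7 * g b)

lemma HA_poly (r : ℝ) : PolyLE 4 (HA r) :=
  (((ps_poly _ _ _ _ _ _ _ _ _ _ _ _).add (ps_poly _ _ _ _ _ _ _ _ _ _ _ _)).add
    (ps_poly _ _ _ _ _ _ _ _ _ _ _ _)).add (ps_poly _ _ _ _ _ _ _ _ _ _ _ _)

lemma HB_poly (r : ℝ) : PolyLE 4 (HB r) :=
  (((ps_poly _ _ _ _ _ _ _ _ _ _ _ _).add (ps_poly _ _ _ _ _ _ _ _ _ _ _ _)).add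
    (ps_poly _ _ _ _ _ _ _ _ _ _ _ _)).add (ps_poly _ _ _ _ _ _ _ _ _ _ _ _)

lemma HC_poly (r : ℝ) : PolyLE 4 (HC r) :=
  ((ps_poly _ _ _ _ _ _ _ _ _ _ _ _).add (ps_poly _ _ _ _ _ _ _ _ _ _ _ _)).add
    (ps_poly _ _ _ _ _ _ _ _ _ _ _ _)

lemma K_split (r : ℝ) (hr : 0 < r) (hr1 : r ≤ 1) :
    ∫ x in (0:ℝ)..1, ∫ y in (0:ℝ)..1, ∫ z in (0:ℝ)..1, FF r x y z =
      bl (HA r) 0 (r / (1 + r)) + bl (HB r) (r / (1 + r)) (r / (1 + r ^ 2)) +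
      bl (HC r) (r / (1 + r ^ 2)) (1 / 2) := by
  have ii := FF_xint r hr.le
  have k1 : r / (1 + r) ≤ r / (1 + r ^ 2) := by gcongr; nlinarith
  have k2 : r / (1 + r ^ 2) ≤ 1 / 2 := by
    rw [div_le_iff₀ (by positivity)]; nlinarith [sq_nonneg (1 - r)]
  rw [← integral_add_adjacent_intervals (ii 0 (1 / 2)) (ii _ _),
    ← integral_add_adjacent_intervals (ii 0 (r / (1 + r ^ 2))) (ii _ _),
    ← integral_add_adjacent_intervals (ii 0 (r / (1 + r))) (ii _ _)]
  change (((∫ x in _.._, HH r x) + ∫ x in _.._, HH r x) + ∫ x in _.._, HH r x) + (∫ x in _.._, HH r x) = _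
  rw [integral_zero_on (a := 1 / 2) (b := 1) (by norm_num) fun x hx _ => HH_half r x hx,
    boole (HA_poly r) (by positivity) fun x h0 h1 => HH_A r x hr hr1 h0 h1,
    boole (HB_poly r) k1 fun x h0 h1 => HH_B r x hr hr1 h0 h1,
    boole (HC_poly r) k2 fun x h0 h1 => HH_C r x hr hr1 h0 h1, add_zero]
  rfl


set_option maxHeartbeats 4000000 in
lemma bl_A (r : ℝ) (hr : 0 < r) : bl (HA r) 0 (r / (1 + r)) =
    ((30)*r^1 + (35)*r^2 + (-17)*r^3 + (-5)*r^4 + (7)*r^5 + (5)*r^6 + (-11)*r^7 + (5)*r^8 + (-1)*r^9) / (120 * (1 + r) ^ 5) := by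
  have : 1 + r ≠ 0 := by positivity
  unfold bl HA ps pc
  field_simp
  ring

set_option maxHeartbeats 4000000 in
lemma bl_B (r : ℝ) (hr : 0 < r) : bl (HB r) (r / (1 + r)) (r / (1 + r ^ 2)) =
    ((30)*r^2 + (-50)*r^3 + (5)*r^4 + (25)*r^5 + (-81)*r^6 + (145)*r^7 + (-99)*r^8 + (85)*r^9 + (-141)*r^10 + (141)*r^11 + (-105)*r^12 + (99)*r^13 + (-91)*r^14 + (51)*r^15 + (-25)*r^16 + (15)*r^17 + (-5)*r^18 + (1)*r^19) / (120 * (1 + r) ^ 5 * (1 + r ^ 2) ^ 5) := by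
  have : 1 + r ≠ 0 := by positivity
  have : 1 + r ^ 2 ≠ 0 := by positivity
  unfold bl HB ps pc
  field_simp
  ring

set_option maxHeartbeats 4000000 in
lemma bl_C (r : ℝ) (hr : 0 < r) : bl (HC r) (r / (1 + r ^ 2)) (1 / 2) =
    ((20)*r^0 + (-135)*r^1 + (423)*r^2 + (-855)*r^3 + (1295)*r^4 + (-1550)*r^5 + (1470)*r^6 + (-1126)*r^7 + (730)*r^8 + (-395)*r^9 + (155)*r^10 + (-35)*r^11 + (3)*r^12) / (480 * (1 + r ^ 2) ^ 5) := by
  have : 1 + r ^ 2 ≠ 0 := by positivity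
  unfold bl HC ps pc
  field_simp
  ring

lemma K_pos (r : ℝ) (hr : 0 < r) (hr1 : r ≤ 1) :
    ∫ x in (0:ℝ)..1, ∫ y in (0:ℝ)..1, ∫ z in (0:ℝ)..1, FF r x y z = KK r := by
  have : 1 + r ≠ 0 := by positivity
  have : 1 + r ^ 2 ≠ 0 := by positivity
  rw [K_split r hr hr1, bl_A r hr, bl_B r hr, bl_C r hr, KK]
  field_simp
  ring

end ITrap

namespace ITrap
open MeasureTheory intervalIntegral

lemma K_zero : ∫ x in (0:ℝ)..1, ∫ y in (0:ℝ)..1, ∫ z in (0:ℝ)..1, FF 0 x y z = KK 0 := by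
  have hH : ∀ x : ℝ, 0 ≤ x → x ≤ 1 / 2 →
      ∫ y in (0:ℝ)..1, ∫ z in (0:ℝ)..1, FF 0 x y z = ps (1/2) 0 1 (-2) 0 1 0 (-1) 0 0 1 0 x := by
    intro x hx0 hx
    apply ps_int _ _ _ _ _ _ _ _ _ _ _ _ _ _ _ _ (by ring) (by ring) zero_le_one
    intro y h0 h1
    rw [FF_z, max_eq_left (by linarith), max_eq_right (by linarith), Phi_1 0 _ _ le_rfl (by linarith)
      (by linarith) (by linarith)]
    unfold pc; ring
  have ii := FF_xint 0 le_rfl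
  rw [← integral_add_adjacent_intervals (ii 0 (1 / 2)) (ii _ _)]
  change _ + ∫ x in _.._, HH 0 x = _
  rw [integral_zero_on (a := 1 / 2) (b := 1) (by norm_num) fun x hx _ => HH_half 0 x hx,
    boole (ps_poly _ _ _ _ _ _ _ _ _ _ _ _) (by norm_num) hH]
  unfold ps pc KK
  norm_num

lemma K_all (r : ℝ) (hr : 0 ≤ r) (hr1 : r ≤ 1) :
    ∫ x in (0:ℝ)..1, ∫ y in (0:ℝ)..1, ∫ z in (0:ℝ)..1, FF r x y z = KK r := by
  rcases hr.eq_or_lt with h | h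
  · rw [← h]; exact K_zero
  · exact K_pos r h hr1

lemma FF_sum (r : ℝ) (hr : 0 ≤ r) (hr1 : r ≤ 1) (h : ℝ) (hh : 0 < h) (M : ℕ)
    (hM : 1 ≤ h * M) (hM2 : h * M ≤ 2) (θ : ℝ) (h0 : 0 ≤ θ) (h1 : θ ≤ 1) :
    |h ^ 3 * ∑ j ∈ Finset.range M, ∑ i ∈ Finset.range M, ∑ l ∈ Finset.range M,
        FF r (h * (j + θ)) (h * (i + θ)) (h * (l + 1)) - KK r| ≤ 7 * h := by
  rw [← K_all r hr hr1]
  exact riem3 (FF r) (FF_anti_x r hr) (FF_anti_y r hr) (FF_anti_z r hr) (FF_nonneg r) (FF_0 r)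
    (FF_sx r) (FF_sy r hr) (FF_sz r) h hh M hM hM2 θ θ 1 h0 h1 h0 h1 zero_le_one le_rfl

/-- lattice points -/
abbrev Pt := ℤ × ℤ

/-- the integer box -/
noncomputable def box (n : ℕ) : Finset Pt := Finset.Icc 1 (n : ℤ) ×ˢ Finset.Icc 1 (n : ℤ)

/-- sup norm -/
def mx (d : Pt) : ℕ := max d.1.natAbs d.2.natAbs

/-- minimum of the absolute coordinates -/
def mn (d : Pt) : ℕ := min d.1.natAbs d.2.natAbs

/-- number of parity classes -/
def par (d : Pt) : ℕ := if d.1 % 2 = 1 ∧ d.2 % 2 = 1 then 2 else 1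

/-- offset -/
def off (d : Pt) (s t : ℤ) : Pt := ((s * d.1 - t * d.2) / 2, (s * d.2 + t * d.1) / 2)

/-- positions -/
noncomputable def XX (n : ℕ) (d : Pt) (s t l : ℤ) : Finset Pt :=
  (box n).filter fun x => x + (l + s) • d ∈ box n ∧ x + off d s t ∈ box n ∧
    x + off d s t + l • d ∈ box n

lemma cnt1 (n : ℕ) (A S T e : ℤ) (he : 2 * e = S - T)
    (hs : (0 ≤ A ∧ 0 ≤ S) ∨ (A ≤ 0 ∧ S ≤ 0)) :
    (((Finset.Icc 1 (n : ℤ)).filter fun x => x + (A + S) ∈ Finset.Icc 1 (n : ℤ) ∧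
      x + e ∈ Finset.Icc 1 (n : ℤ) ∧ x + e + A ∈ Finset.Icc 1 (n : ℤ)).card : ℝ) =
    max 0 ((n : ℝ) - |(A : ℝ)| - |(S : ℝ)| / 2 - max (|(S : ℝ)| / 2) (|(T : ℝ)| / 2)) := by
  obtain ⟨w, hw⟩ : ∃ w : ℤ, 2 * w = 2 * |A| + |S| + max |S| |T| := by
    refine ⟨(2 * |A| + |S| + max |S| |T|) / 2, ?_⟩
    rcases max_cases |S| |T| with h | h <;> rcases abs_cases S with h' | h' <;>
      rcases abs_cases T with h'' | h'' <;> omega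
  obtain ⟨m, hm⟩ : ∃ m : ℤ, m = min (min 0 (A + S)) (min e (e + A)) := ⟨_, rfl⟩
  have hMx : max (max 0 (A + S)) (max e (e + A)) = m + w := by
    rcases max_cases |S| |T| with h | h <;> rcases abs_cases S with h' | h' <;>
      rcases abs_cases T with h'' | h'' <;> rcases abs_cases A with h3 | h3 <;> omega
  have e1 : ((Finset.Icc 1 (n : ℤ)).filter fun x => x + (A + S) ∈ Finset.Icc 1 (n : ℤ) ∧
      x + e ∈ Finset.Icc 1 (n : ℤ) ∧ x + e + A ∈ Finset.Icc 1 (n : ℤ)) =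
      Finset.Icc (1 - m) (n - (m + w)) := by
    ext x
    simp only [Finset.mem_filter, Finset.mem_Icc]
    rw [← hMx, hm]
    omega
  rw [e1, Int.card_Icc]
  have e2 : (((n - (m + w) + 1 - (1 - m)).toNat : ℤ) : ℝ) = max 0 ((n : ℝ) - w) := by
    rw [Int.toNat_eq_max]
    push_cast
    rw [max_comm]; congr 1; ring
  have hw' : 2 * (w : ℝ) = 2 * |(A : ℝ)| + |(S : ℝ)| + max |(S : ℝ)| |(T : ℝ)| := by
    exact_mod_cast hw
  have e3 : max (|(S : ℝ)| / 2) (|(T : ℝ)| / 2) = max |(S : ℝ)| |(T : ℝ)| / 2 := by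
    rw [max_div_div_right (by norm_num)]
  rw [e3]
  calc (((n - (m + w) + 1 - (1 - m)).toNat : ℕ) : ℝ)
      = (((n - (m + w) + 1 - (1 - m)).toNat : ℤ) : ℝ) := (Int.cast_natCast _).symm
    _ = _ := by rw [e2]; congr 1; linarith

lemma XX_card (n : ℕ) (d : Pt) (s t l : ℤ) (hs : 0 ≤ s) (ht : 0 ≤ t) (hl : 0 ≤ l)
    (h1 : 2 ∣ s * d.1 - t * d.2) (h2 : 2 ∣ s * d.2 + t * d.1) :
    ((XX n d s t l).card : ℝ) =
      max 0 ((n : ℝ) - l * d.1.natAbs - s * d.1.natAbs / 2 -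
        max (s * d.1.natAbs / 2 : ℝ) (t * d.2.natAbs / 2)) *
      max 0 ((n : ℝ) - l * d.2.natAbs - s * d.2.natAbs / 2 -
        max (s * d.2.natAbs / 2 : ℝ) (t * d.1.natAbs / 2)) := by
  have key : XX n d s t l =
      ((Finset.Icc 1 (n : ℤ)).filter fun x => x + (l * d.1 + s * d.1) ∈ Finset.Icc 1 (n : ℤ) ∧
      x + (off d s t).1 ∈ Finset.Icc 1 (n : ℤ) ∧ x + (off d s t).1 + l * d.1 ∈ Finset.Icc 1 (n : ℤ)) ×ˢ
      ((Finset.Icc 1 (n : ℤ)).filter fun x => x + (l * d.2 + s * d.2) ∈ Finset.Icc 1 (n : ℤ) ∧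
      x + (off d s t).2 ∈ Finset.Icc 1 (n : ℤ) ∧ x + (off d s t).2 + l * d.2 ∈ Finset.Icc 1 (n : ℤ)) := by
    ext ⟨x, y⟩
    simp only [XX, box, Finset.mem_filter, Finset.mem_product, Prod.fst_add, Prod.snd_add,
      Prod.smul_fst, Prod.smul_snd, smul_eq_mul, add_mul]
    tauto
  have sg : ∀ z : ℤ, (0 ≤ l * z ∧ 0 ≤ s * z) ∨ (l * z ≤ 0 ∧ s * z ≤ 0) := by
    intro z
    rcases le_total 0 z with h | h
    · exact Or.inl ⟨mul_nonneg hl h, mul_nonneg hs h⟩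
    · exact Or.inr ⟨mul_nonpos_of_nonneg_of_nonpos hl h, mul_nonpos_of_nonneg_of_nonpos hs h⟩
  have ab : ∀ (k z : ℤ), 0 ≤ k → |((k * z : ℤ) : ℝ)| = k * (z.natAbs : ℝ) := by
    intro k z hk
    have : (0:ℝ) ≤ k := by exact_mod_cast hk
    rw [Int.cast_mul, abs_mul, abs_of_nonneg this, Nat.cast_natAbs, Int.cast_abs]
  have o1 : 2 * (off d s t).1 = s * d.1 - t * d.2 := by simp only [off]; omega
  have o2 : 2 * (off d s t).2 = s * d.2 - (t * (-d.1)) := by simp only [off]; rw [mul_neg]; omega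
  rw [key, Finset.card_product, Nat.cast_mul, cnt1 n _ _ _ _ o1 (sg _), cnt1 n _ _ _ _ o2 (sg _)]
  simp only [ab _ _ hs, ab _ _ ht, ab _ _ hl, Int.natAbs_neg]

/-- number of parameters for the direction `d` -/
noncomputable def NN (n : ℕ) (d : Pt) : ℕ :=
  ∑ e ∈ Finset.range (par d), ∑ j ∈ Finset.range (n / mx d + 1), ∑ i ∈ Finset.range (n / mx d + 1),
    ∑ l ∈ Finset.range (n / mx d + 1),
      (XX n d (2 * (j + 1) - e) (2 * (i + 1) - e) (l + 1)).card

/-- main term -/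
noncomputable def gg (d : Pt) : ℝ := par d * KK ((mn d : ℝ) / mx d) / (mx d : ℝ) ^ 3

lemma XX_FF (n : ℕ) (hn : 0 < n) (d : Pt) (ha : 0 < mx d) (e : ℕ) (he : e < par d) (j i l : ℕ) :
    ((XX n d (2 * (j + 1) - e) (2 * (i + 1) - e) (l + 1)).card : ℝ) =
      (n : ℝ) ^ 2 * FF ((mn d : ℝ) / mx d) ((mx d : ℝ) / n * (j + (1 - (e : ℝ) / 2)))
        ((mx d : ℝ) / n * (i + (1 - (e : ℝ) / 2))) ((mx d : ℝ) / n * (l + 1)) := by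
  have he2 : e ≤ 1 := by unfold par at he; split_ifs at he <;> omega
  have hpar : e = 1 → d.1 % 2 = 1 ∧ d.2 % 2 = 1 := by
    intro h; by_contra hc; unfold par at he; rw [if_neg hc] at he; omega
  have hd : 2 ∣ (2 * (j + 1) - e : ℤ) * d.1 - (2 * (i + 1) - e) * d.2 ∧
      2 ∣ (2 * (j + 1) - e : ℤ) * d.2 + (2 * (i + 1) - e) * d.1 := by
    rcases Nat.le_one_iff_eq_zero_or_eq_one.mp he2 with h | h
    · subst h
      constructor
      · exact ⟨(j + 1) * d.1 - (i + 1) * d.2, by push_cast; ring⟩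
      · exact ⟨(j + 1) * d.2 + (i + 1) * d.1, by push_cast; ring⟩
    · obtain ⟨p1, p2⟩ := hpar h
      obtain ⟨u, hu⟩ : ∃ u, d.1 = 2 * u + 1 := ⟨d.1 / 2, by omega⟩
      obtain ⟨v, hv⟩ : ∃ v, d.2 = 2 * v + 1 := ⟨d.2 / 2, by omega⟩
      subst h
      rw [hu, hv]
      constructor
      · exact ⟨(2 * j + 1) * u - (2 * i + 1) * v + j - i, by push_cast; ring⟩
      · exact ⟨(2 * j + 1) * v + (2 * i + 1) * u + j + i + 1, by push_cast; ring⟩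
  rw [XX_card n d _ _ _ (by omega) (by omega) (by omega) hd.1 hd.2]
  have hn' : (0:ℝ) < n := by exact_mod_cast hn
  have ha' : (0:ℝ) < mx d := by exact_mod_cast ha
  have gen : ∀ a b : ℝ, 0 < a → ∀ s t l : ℝ,
      max 0 (n - l * a - s * a / 2 - max (s * a / 2) (t * b / 2)) *
      max 0 (n - l * b - s * b / 2 - max (s * b / 2) (t * a / 2)) =
      (n : ℝ) ^ 2 * FF (b / a) (a / n * (s / 2)) (a / n * (t / 2)) (a / n * l) := by
    intro a b ha s t l
    unfold FF
    have m1 : ∀ x : ℝ, max 0 x = n * max 0 (x / n) := by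
      intro x; rw [mul_max_of_nonneg _ _ hn'.le]; congr 1
      · simp
      · field_simp
    have m2 : ∀ x y : ℝ, max x y / n = max (x / n) (y / n) := fun x y => by
      rw [max_div_div_right hn'.le]
    rw [m1 (n - l * a - s * a / 2 - max (s * a / 2) (t * b / 2)),
      m1 (n - l * b - s * b / 2 - max (s * b / 2) (t * a / 2))]
    rw [sub_div, sub_div _ (max (s * b / 2) (t * a / 2)), m2, m2]
    have q1 : (n - l * a - s * a / 2) / n = 1 - a / n * l - a / n * (s / 2) := by field_simp
    have q2 : (n - l * b - s * b / 2) / n = 1 - b / a * (a / n * l) - b / a * (a / n * (s / 2)) := by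
      field_simp
    have q3 : s * a / 2 / n = a / n * (s / 2) := by field_simp
    have q4 : t * b / 2 / n = b / a * (a / n * (t / 2)) := by field_simp
    have q5 : s * b / 2 / n = b / a * (a / n * (s / 2)) := by field_simp
    have q6 : t * a / 2 / n = a / n * (t / 2) := by field_simp
    rw [q1, q2, q3, q4, q5, q6]
    ring
  have z1 : (((2 * ((j : ℤ) + 1) - e : ℤ) : ℝ)) = 2 * (j + (1 - (e : ℝ) / 2)) := by push_cast; ring
  have z2 : (((2 * ((i : ℤ) + 1) - e : ℤ) : ℝ)) = 2 * (i + (1 - (e : ℝ) / 2)) := by push_cast; ring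
  rcases le_total d.2.natAbs d.1.natAbs with h | h
  · have w1 : mx d = d.1.natAbs := max_eq_left h
    have w2 : mn d = d.2.natAbs := min_eq_right h
    rw [w1] at ha'
    rw [w1, w2, gen _ _ ha', z1, z2]
    push_cast
    congr 2 <;> ring
  · have w1 : mx d = d.2.natAbs := max_eq_right h
    have w2 : mn d = d.1.natAbs := min_eq_left h
    rw [w1] at ha'
    rw [w1, w2, mul_comm, gen _ _ ha', z1, z2]
    push_cast
    congr 2 <;> ring

lemma NN_bound (n : ℕ) (d : Pt) (ha : 0 < mx d) (han : mx d ≤ n) :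
    |(NN n d : ℝ) - gg d * (n : ℝ) ^ 5| ≤ 14 * (n : ℝ) ^ 4 / (mx d : ℝ) ^ 2 := by
  have hn : 0 < n := ha.trans_le han
  have hn' : (0:ℝ) < n := by exact_mod_cast hn
  have ha' : (0:ℝ) < mx d := by exact_mod_cast ha
  set h : ℝ := (mx d : ℝ) / n with hh
  set r : ℝ := (mn d : ℝ) / mx d with hr
  set M := n / mx d + 1 with hM
  have hpos : 0 < h := by positivity
  have hM1 : 1 ≤ h * M := by
    rw [hh, div_mul_eq_mul_div, le_div_iff₀ hn', one_mul]
    have := Nat.lt_mul_div_succ n ha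
    exact_mod_cast this.le
  have hM2 : h * M ≤ 2 := by
    rw [hh, div_mul_eq_mul_div, div_le_iff₀ hn']
    have := Nat.mul_div_le n (mx d)
    have : mx d * M ≤ 2 * n := by rw [hM, mul_add]; omega
    exact_mod_cast this
  have hr1 : r ≤ 1 := by
    rw [hr, div_le_one ha']
    have : mn d ≤ mx d := min_le_max
    exact_mod_cast this
  set S : ℕ → ℝ := fun e => ∑ j ∈ Finset.range M, ∑ i ∈ Finset.range M, ∑ l ∈ Finset.range M,
        FF r (h * (j + (1 - (e : ℝ) / 2))) (h * (i + (1 - (e : ℝ) / 2))) (h * (l + 1)) with hS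
  have hN : (NN n d : ℝ) = ∑ e ∈ Finset.range (par d), (n : ℝ) ^ 2 * S e := by
    unfold NN
    push_cast
    refine Finset.sum_congr rfl fun e he => ?_
    simp only [hS, Finset.mul_sum]
    refine Finset.sum_congr rfl fun j _ => Finset.sum_congr rfl fun i _ =>
      Finset.sum_congr rfl fun l _ => ?_
    exact XX_FF n hn d ha e (Finset.mem_range.mp he) j i l
  have hg : gg d * (n : ℝ) ^ 5 = ∑ e ∈ Finset.range (par d), (n : ℝ) ^ 2 * (KK r / h ^ 3) := by
    rw [Finset.sum_const, Finset.card_range, nsmul_eq_mul, gg, ← hr, hh]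
    field_simp
  have hp2 : par d ≤ 2 := by unfold par; split_ifs <;> omega
  rw [hN, hg, ← Finset.sum_sub_distrib]
  refine (Finset.abs_sum_le_sum_abs _ _).trans ?_
  have each : ∀ e ∈ Finset.range (par d), |(n : ℝ) ^ 2 * S e - (n : ℝ) ^ 2 * (KK r / h ^ 3)| ≤
      7 * (n : ℝ) ^ 4 / (mx d : ℝ) ^ 2 := by
    intro e he
    have he1 : (e : ℝ) ≤ 1 := by
      have : e ≤ 1 := by have := Finset.mem_range.mp he; omega
      exact_mod_cast this
    have he0 : (0 : ℝ) ≤ e := Nat.cast_nonneg e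
    have := FF_sum r (by positivity) hr1 h hpos M hM1 hM2 (1 - (e : ℝ) / 2) (by linarith) (by linarith)
    have eq : (n : ℝ) ^ 2 * S e - (n : ℝ) ^ 2 * (KK r / h ^ 3) =
        (n : ℝ) ^ 2 / h ^ 3 * (h ^ 3 * S e - KK r) := by field_simp
    have hc : 0 < (n : ℝ) ^ 2 / h ^ 3 := by positivity
    rw [eq, abs_mul, abs_of_pos hc]
    refine (mul_le_mul_of_nonneg_left this hc.le).trans (le_of_eq ?_)
    rw [hh]; field_simp
  refine (Finset.sum_le_sum each).trans ?_
  rw [Finset.sum_const, Finset.card_range, nsmul_eq_mul]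
  have : (par d : ℝ) ≤ 2 := by exact_mod_cast hp2
  have hc : 0 ≤ 7 * (n : ℝ) ^ 4 / (mx d : ℝ) ^ 2 := by positivity
  calc (par d : ℝ) * (7 * (n : ℝ) ^ 4 / (mx d : ℝ) ^ 2) ≤ 2 * (7 * (n : ℝ) ^ 4 / (mx d : ℝ) ^ 2) :=
        mul_le_mul_of_nonneg_right this hc
    _ = _ := by ring

end ITrap

namespace ITrap

/-- the plane -/
abbrev Pl := EuclideanSpace ℝ (Fin 2)

lemma sphere_coord {p c : Pl} {ρ : ℝ} (hρ : 0 ≤ ρ) :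
    p ∈ Metric.sphere c ρ ↔ (p 0 - c 0) ^ 2 + (p 1 - c 1) ^ 2 = ρ ^ 2 := by
  rw [Metric.mem_sphere, EuclideanSpace.dist_eq, Fin.sum_univ_two, Real.dist_eq, Real.dist_eq,
    sq_abs, sq_abs, Real.sqrt_eq_iff_mul_self_eq (by positivity) hρ]
  constructor <;> intro h <;> linarith

lemma dist_coord {p c q b : Pl} (h : dist p c = dist q b) :
    (p 0 - c 0) ^ 2 + (p 1 - c 1) ^ 2 = (q 0 - b 0) ^ 2 + (q 1 - b 1) ^ 2 := by
  have h1 : p ∈ Metric.sphere c (dist q b) := h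
  rw [sphere_coord dist_nonneg] at h1
  have h2 : q ∈ Metric.sphere b (dist q b) := rfl
  rw [sphere_coord dist_nonneg] at h2
  rw [h1, h2]

lemma refl_coord {φ : Pl ≃ᵃⁱ[ℝ] Pl} {L : AffineSubspace ℝ Pl}
    (h1 : Module.finrank ℝ L.direction = 1) (h2 : ∀ x, φ x = x ↔ x ∈ L) :
    ∃ o e : Pl, 0 < e 0 ^ 2 + e 1 ^ 2 ∧
      (∀ x, e 0 * φ x 0 + e 1 * φ x 1 = e 0 * x 0 + e 1 * x 1 ∧
        -e 1 * (φ x 0 + x 0 - 2 * o 0) + e 0 * (φ x 1 + x 1 - 2 * o 1) = 0) := by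
  obtain ⟨⟨e, he⟩, hne, hsp⟩ := finrank_eq_one_iff'.mp h1
  have hL : (L : Set Pl).Nonempty := by
    rw [AffineSubspace.nonempty_iff_ne_bot]
    rintro rfl
    rw [AffineSubspace.direction_bot, finrank_bot] at h1
    omega
  obtain ⟨o, ho⟩ := hL
  have ho : o ∈ L := ho
  have hoe : e +ᵥ o ∈ L := AffineSubspace.vadd_mem_of_mem_direction he ho
  have e0 : 0 < e 0 ^ 2 + e 1 ^ 2 := by
    by_contra hc
    apply hne
    have a0 : e 0 = 0 := by nlinarith [sq_nonneg (e 0), sq_nonneg (e 1)]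
    have a1 : e 1 = 0 := by nlinarith [sq_nonneg (e 0), sq_nonneg (e 1)]
    apply Subtype.ext
    ext i
    fin_cases i <;> simp [a0, a1]
  refine ⟨o, e, e0, fun x => ?_⟩
  have fo := (h2 o).mpr ho
  have foe := (h2 _).mpr hoe
  have d1 : dist (φ x) o = dist x o := by conv_lhs => rw [← fo]; rw [φ.dist_map]
  have d2 : dist (φ x) (e +ᵥ o) = dist x (e +ᵥ o) := by conv_lhs => rw [← foe]; rw [φ.dist_map]
  have d1 := dist_coord d1
  have d2 := dist_coord d2
  simp only [vadd_eq_add, PiLp.add_apply] at d2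
  have E1 : e 0 * φ x 0 + e 1 * φ x 1 = e 0 * x 0 + e 1 * x 1 := by linarith
  refine ⟨E1, ?_⟩
  by_cases hx : φ x = x
  · have hxL := (h2 x).mp hx
    obtain ⟨c, hc⟩ := hsp ⟨x -ᵥ o, AffineSubspace.vsub_mem_direction hxL ho⟩
    have hc : c • e = x - o := congrArg Subtype.val hc
    have c0 : c * e 0 = x 0 - o 0 := by simpa using congrArg (fun v : Pl => v 0) hc
    have c1 : c * e 1 = x 1 - o 1 := by simpa using congrArg (fun v : Pl => v 1) hc
    rw [hx]
    linear_combination 2 * e 1 * c0 - 2 * e 0 * c1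
  · obtain ⟨a, ha⟩ : ∃ a, a = (-e 1 * (φ x 0 - x 0) + e 0 * (φ x 1 - x 1)) / (e 0 ^ 2 + e 1 ^ 2) :=
      ⟨_, rfl⟩
    have ha := (eq_div_iff e0.ne').mp ha
    have x0 : φ x 0 - x 0 = - a * e 1 := by
      have : (e 0 ^ 2 + e 1 ^ 2) * (φ x 0 - x 0 + a * e 1) = 0 := by
        linear_combination e 1 * ha + e 0 * E1
      rcases mul_eq_zero.mp this with h | h <;> linarith
    have x1 : φ x 1 - x 1 = a * e 0 := by
      have : (e 0 ^ 2 + e 1 ^ 2) * (φ x 1 - x 1 - a * e 0) = 0 := by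
        linear_combination -e 0 * ha + e 1 * E1
      rcases mul_eq_zero.mp this with h | h <;> linarith
    have : a * (-e 1 * (φ x 0 + x 0 - 2 * o 0) + e 0 * (φ x 1 + x 1 - 2 * o 1)) = 0 := by
      linear_combination d1 - (φ x 0 + x 0 - 2 * o 0) * x0 - (φ x 1 + x 1 - 2 * o 1) * x1
    rcases mul_eq_zero.mp this with h | h
    · exfalso; apply hx; ext i; fin_cases i
      · simp; rw [h] at x0; linarith
      · simp; rw [h] at x1; linarith
    · exact h

lemma ext_coord {e : Pl} (he : 0 < e 0 ^ 2 + e 1 ^ 2) {p q : Pl}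
    (h1 : e 0 * p 0 + e 1 * p 1 = e 0 * q 0 + e 1 * q 1)
    (h2 : -e 1 * p 0 + e 0 * p 1 = - e 1 * q 0 + e 0 * q 1) : p = q := by
  ext i; fin_cases i
  · have : (e 0 ^ 2 + e 1 ^ 2) * (p 0 - q 0) = 0 := by linear_combination e 0 * h1 - e 1 * h2
    rcases mul_eq_zero.mp this with h | h
    · linarith
    · simp; linarith
  · have : (e 0 ^ 2 + e 1 ^ 2) * (p 1 - q 1) = 0 := by linear_combination e 1 * h1 + e 0 * h2
    rcases mul_eq_zero.mp this with h | h
    · linarith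
    · simp; linarith

/-- no three distinct collinear points are concyclic -/
lemma collin {o e : Pl} (he : 0 < e 0 ^ 2 + e 1 ^ 2) (p : Fin 3 → Pl) (c : Pl) (R : ℝ)
    (hl : ∀ i, -e 1 * (p i 0 - o 0) + e 0 * (p i 1 - o 1) = 0)
    (hc : ∀ i, (p i 0 - c 0) ^ 2 + (p i 1 - c 1) ^ 2 = R) (h01 : p 0 ≠ p 1) (h02 : p 0 ≠ p 2)
    (h12 : p 1 ≠ p 2) : False := by
  obtain ⟨s, hs⟩ : ∃ s : Fin 3 → ℝ, ∀ i, s i * (e 0 ^ 2 + e 1 ^ 2) =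
    e 0 * (p i 0 - o 0) + e 1 * (p i 1 - o 1) := ⟨fun i =>
      (e 0 * (p i 0 - o 0) + e 1 * (p i 1 - o 1)) / (e 0 ^ 2 + e 1 ^ 2), fun i => by field_simp⟩
  have hne : ∀ i j, p i ≠ p j → s i - s j ≠ 0 := by
    intro i j hij h
    apply hij
    have := hs i
    rw [show s i = s j by linarith, hs j] at this
    apply ext_coord he
    · linarith
    · linarith [hl i, hl j]
  have x0 : ∀ i, p i 0 = o 0 + s i * e 0 := by
    intro i
    have : (e 0 ^ 2 + e 1 ^ 2) * (p i 0 - o 0 - s i * e 0) = 0 := by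
      linear_combination - e 0 * hs i - e 1 * hl i
    rcases mul_eq_zero.mp this with h | h <;> linarith
  have x1 : ∀ i, p i 1 = o 1 + s i * e 1 := by
    intro i
    have : (e 0 ^ 2 + e 1 ^ 2) * (p i 1 - o 1 - s i * e 1) = 0 := by
      linear_combination - e 1 * hs i + e 0 * hl i
    rcases mul_eq_zero.mp this with h | h <;> linarith
  have q : ∀ i j, p i ≠ p j → (s i + s j) * (e 0 ^ 2 + e 1 ^ 2) +
      2 * ((o 0 - c 0) * e 0 + (o 1 - c 1) * e 1) = 0 := by
    intro i j hij
    have h := (hc i).trans (hc j).symm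
    rw [x0 i, x1 i, x0 j, x1 j] at h
    have : (s i - s j) * ((s i + s j) * (e 0 ^ 2 + e 1 ^ 2) +
      2 * ((o 0 - c 0) * e 0 + (o 1 - c 1) * e 1)) = 0 := by linear_combination h
    exact (mul_eq_zero.mp this).resolve_left (hne i j hij)
  have a := q 0 1 h01
  have b := q 0 2 h02
  have : (s 1 - s 2) * (e 0 ^ 2 + e 1 ^ 2) = 0 := by linear_combination a - b
  rcases mul_eq_zero.mp this with h | h
  · exact hne 1 2 h12 h
  · linarith

lemma structE (S : Finset Pl) (h : IsIsoscelesTrapezium (S : Set Pl)) :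
    ∃ u u' y z : Pl, S = {u, u', y, z} ∧ u ≠ u' ∧ u ≠ y ∧ u ≠ z ∧ u' ≠ y ∧ u' ≠ z ∧ y ≠ z ∧
    (∃ (c : Pl) (R : ℝ), ∀ p ∈ S, (p 0 - c 0) ^ 2 + (p 1 - c 1) ^ 2 = R) ∧
    (((u' 0 - u 0) * (z 1 - y 1) = (u' 1 - u 1) * (z 0 - y 0) ∧
      (u' 0 - u 0) * (y 0 + z 0 - u 0 - u' 0) + (u' 1 - u 1) * (y 1 + z 1 - u 1 - u' 1) = 0) ∨
     ((u' 0 - u 0) * (2 * y 0 - u 0 - u' 0) + (u' 1 - u 1) * (2 * y 1 - u 1 - u' 1) = 0 ∧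
      (u' 0 - u 0) * (2 * z 0 - u 0 - u' 0) + (u' 1 - u 1) * (2 * z 1 - u 1 - u' 1) = 0)) := by
  classical
  obtain ⟨h4, ⟨c, ρ, hρ, hc⟩, φ, ⟨L, hL1, hL2⟩, hφ⟩ := h
  rw [Set.ncard_coe_finset] at h4
  have hc : ∀ p ∈ S, (p 0 - c 0) ^ 2 + (p 1 - c 1) ^ 2 = ρ ^ 2 := fun p hp =>
    (sphere_coord hρ.le).mp (hc hp)
  obtain ⟨o, e, he, hr⟩ := refl_coord hL1 hL2
  have inv : ∀ x, φ (φ x) = x := fun x =>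
    ext_coord he (by linarith [(hr x).1, (hr (φ x)).1]) (by linarith [(hr x).2, (hr (φ x)).2])
  have hS : ∀ x ∈ S, φ x ∈ S := by
    intro x hx
    have : φ x ∈ (S : Set Pl) := by rw [← hφ]; exact Set.mem_image_of_mem _ hx
    exact this
  obtain ⟨u, hu, hne⟩ : ∃ u ∈ S, φ u ≠ u := by
    by_contra! hcon
    obtain ⟨T, hT, hT3⟩ := Finset.exists_subset_card_eq (s := S) (n := 3) (by omega)
    obtain ⟨a, b, g, hab, hag, hbg, rfl⟩ := Finset.card_eq_three.mp hT3
    have ha : a ∈ S := hT (by simp)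
    have hb : b ∈ S := hT (by simp)
    have hg : g ∈ S := hT (by simp)
    refine collin he (o := o) ![a, b, g] c (ρ ^ 2) ?_ ?_ hab hag hbg
    · have key : ∀ x ∈ S, -e 1 * (x 0 - o 0) + e 0 * (x 1 - o 1) = 0 := by
        intro x hx
        have := (hr x).2
        rw [hcon x hx] at this
        linarith
      intro i; fin_cases i
      · exact key a ha
      · exact key b hb
      · exact key g hg
    · intro i; fin_cases i
      · exact hc a ha
      · exact hc b hb
      · exact hc g hg
  have hu' := hS u hu
  obtain ⟨T, hTdef⟩ : ∃ T, T = (S.erase u).erase (φ u) := ⟨_, rfl⟩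
  have hT2 : T.card = 2 := by
    rw [hTdef, Finset.card_erase_of_mem (Finset.mem_erase.mpr ⟨hne, hu'⟩),
      Finset.card_erase_of_mem hu, h4]
  obtain ⟨y, z, hyz, hTe⟩ := Finset.card_eq_two.mp hT2
  have hy : y ∈ T := by rw [hTe]; simp
  have hz : z ∈ T := by rw [hTe]; simp
  have hφT : ∀ x ∈ T, φ x ∈ T := by
    intro x hx
    rw [hTdef, Finset.mem_erase, Finset.mem_erase] at hx ⊢
    refine ⟨fun h => hx.2.1 (φ.injective h), fun h => hx.1 ?_, hS x hx.2.2⟩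
    rw [← h, inv]
  have hSe : S = {u, φ u, y, z} := by
    rw [← Finset.insert_erase hu, ← Finset.insert_erase (Finset.mem_erase.mpr ⟨hne, hu'⟩),
      ← hTdef, hTe]
  have hy' := hy
  have hz' := hz
  rw [hTdef, Finset.mem_erase, Finset.mem_erase] at hy' hz'
  refine ⟨u, φ u, y, z, hSe, hne.symm, hy'.2.1.symm, hz'.2.1.symm, hy'.1.symm, hz'.1.symm, hyz,
    ⟨c, ρ ^ 2, hc⟩, ?_⟩
  have par : ∀ x, ∃ a, φ x 0 - x 0 = - a * e 1 ∧ φ x 1 - x 1 = a * e 0 := by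
    intro x
    refine ⟨(-e 1 * (φ x 0 - x 0) + e 0 * (φ x 1 - x 1)) / (e 0 ^ 2 + e 1 ^ 2), ?_, ?_⟩
    · field_simp; linear_combination e 0 * (hr x).1
    · field_simp; linear_combination e 1 * (hr x).1
  obtain ⟨a, a0, a1⟩ := par u
  have hru := (hr u).2
  have fy := hφT y hy
  have fz := hφT z hz
  rw [hTe] at fy fz
  simp only [Finset.mem_insert, Finset.mem_singleton] at fy fz
  rcases fy with fy | fy
  · right
    have fz : φ z = z := by
      rcases fz with h | h
      · exfalso; apply hyz; rw [← inv z, h, fy]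
      · exact h
    have ry := (hr y).2
    have rz := (hr z).2
    rw [fy] at ry
    rw [fz] at rz
    rw [a0, a1]
    constructor
    · linear_combination a * ry - a * hru
    · linear_combination a * rz - a * hru
  · left
    obtain ⟨b, b0, b1⟩ := par y
    have ry := (hr y).2
    rw [fy] at ry b0 b1
    rw [a0, a1, b0, b1]
    constructor
    · ring
    · linear_combination a * ry - a * hru

end ITrap

namespace ITrap

/-- embedding of lattice points -/
noncomputable def io (p : Pt) : Pl := !₂[(p.1 : ℝ), (p.2 : ℝ)]

@[simp] lemma io_0 (p : Pt) : io p 0 = p.1 := rfl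
@[simp] lemma io_1 (p : Pt) : io p 1 = p.2 := rfl

lemma io_inj : Function.Injective io := by
  intro p q h
  have h0 : io p 0 = io q 0 := by rw [h]
  have h1 : io p 1 = io q 1 := by rw [h]
  rw [io_0, io_0, Int.cast_inj] at h0
  rw [io_1, io_1, Int.cast_inj] at h1
  exact Prod.ext h0 h1

/-- being a trapezium, on lattice sets -/
def IT (Q : Finset Pt) : Prop := IsIsoscelesTrapezium (io '' (Q : Set Pt))

lemma structZ (Q : Finset Pt) (h : IT Q) :
    ∃ u u' y z : Pt, Q = {u, u', y, z} ∧ u ≠ u' ∧ u ≠ y ∧ u ≠ z ∧ u' ≠ y ∧ u' ≠ z ∧ y ≠ z ∧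
    (∃ (a b : ℝ) (R : ℝ), ∀ p ∈ Q, (p.1 - a) ^ 2 + (p.2 - b) ^ 2 = R) ∧
    (((u'.1 - u.1) * (z.2 - y.2) = (u'.2 - u.2) * (z.1 - y.1) ∧
      (u'.1 - u.1) * (y.1 + z.1 - u.1 - u'.1) + (u'.2 - u.2) * (y.2 + z.2 - u.2 - u'.2) = 0) ∨
     ((u'.1 - u.1) * (2 * y.1 - u.1 - u'.1) + (u'.2 - u.2) * (2 * y.2 - u.2 - u'.2) = 0 ∧
      (u'.1 - u.1) * (2 * z.1 - u.1 - u'.1) + (u'.2 - u.2) * (2 * z.2 - u.2 - u'.2) = 0)) := by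
  classical
  have h' : IsIsoscelesTrapezium ((Q.image io : Finset Pl) : Set Pl) := by
    rw [Finset.coe_image]; exact h
  obtain ⟨u, u', y, z, hS, n1, n2, n3, n4, n5, n6, ⟨c, R, hc⟩, hh⟩ := structE _ h'
  have hu : u ∈ Q.image io := by rw [hS]; simp
  have hu' : u' ∈ Q.image io := by rw [hS]; simp
  have hy : y ∈ Q.image io := by rw [hS]; simp
  have hz : z ∈ Q.image io := by rw [hS]; simp
  obtain ⟨u, -, rfl⟩ := Finset.mem_image.mp hu
  obtain ⟨u', -, rfl⟩ := Finset.mem_image.mp hu'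
  obtain ⟨y, -, rfl⟩ := Finset.mem_image.mp hy
  obtain ⟨z, -, rfl⟩ := Finset.mem_image.mp hz
  refine ⟨u, u', y, z, ?_, ne_of_apply_ne _ n1, ne_of_apply_ne _ n2, ne_of_apply_ne _ n3,
    ne_of_apply_ne _ n4, ne_of_apply_ne _ n5, ne_of_apply_ne _ n6,
    ⟨c 0, c 1, R, fun p hp => by simpa using hc _ (Finset.mem_image_of_mem io hp)⟩, ?_⟩
  · apply Finset.image_injective io_inj
    rw [hS]
    simp [Finset.image_insert]
  · simp only [io_0, io_1] at hh
    rcases hh with ⟨a, b⟩ | ⟨a, b⟩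
    · left; exact ⟨by exact_mod_cast a, by exact_mod_cast b⟩
    · right; exact ⟨by exact_mod_cast a, by exact_mod_cast b⟩

lemma refl_apply (m f p q : Pl) (hs : (q 0 - p 0) * f 0 + (q 1 - p 1) * f 1 = 0) (c : ℝ)
    (h0 : p 0 + q 0 - 2 * m 0 = c * f 0) (h1 : p 1 + q 1 - 2 * m 1 = c * f 1) :
    EuclideanGeometry.reflection (AffineSubspace.mk' m (Submodule.span ℝ {f})) p = q := by
  have hmid : (c / 2) • f +ᵥ m ∈ AffineSubspace.mk' m (Submodule.span ℝ {f}) := by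
    rw [AffineSubspace.mem_mk']
    simp only [vadd_vsub]
    exact Submodule.smul_mem _ _ (Submodule.mem_span_singleton_self f)
  have hv : (1 / 2 : ℝ) • (p - q) ∈ (AffineSubspace.mk' m (Submodule.span ℝ {f})).directionᗮ := by
    rw [AffineSubspace.direction_mk', Submodule.mem_orthogonal_singleton_iff_inner_right]
    simp [PiLp.inner_apply, Fin.sum_univ_two]
    linarith
  have key := EuclideanGeometry.reflection_orthogonal_vadd hmid hv
  have e1 : (1 / 2 : ℝ) • (p - q) +ᵥ (c / 2) • f +ᵥ m = p := by
    ext i; fin_cases i <;> simp [vadd_eq_add] <;> linarith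
  have e2 : -((1 / 2 : ℝ) • (p - q)) +ᵥ (c / 2) • f +ᵥ m = q := by
    ext i; fin_cases i <;> simp [vadd_eq_add] <;> linarith
  rwa [e1, e2] at key

/-- sufficient condition to be a trapezium -/
lemma IT_of (u u' y z d : Pt) (k l s t : ℤ) (hd : d ≠ 0) (hk : 0 < k) (ht : 0 < t)
    (hks : k = l + s)
    (n1 : u ≠ u') (n2 : u ≠ y) (n3 : u ≠ z) (n4 : u' ≠ y) (n5 : u' ≠ z) (n6 : y ≠ z)
    (a1 : u'.1 = u.1 + k * d.1) (a2 : u'.2 = u.2 + k * d.2)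
    (b1 : z.1 = y.1 + l * d.1) (b2 : z.2 = y.2 + l * d.2)
    (c1 : 2 * y.1 = 2 * u.1 + s * d.1 - t * d.2) (c2 : 2 * y.2 = 2 * u.2 + s * d.2 + t * d.1) :
    IT {u, u', y, z} := by
  have hdR : 0 < (d.1 : ℝ) ^ 2 + (d.2 : ℝ) ^ 2 := by
    have : 0 < d.1 ^ 2 + d.2 ^ 2 := by
      rcases eq_or_ne d.1 0 with h | h
      · have : d.2 ≠ 0 := fun h' => hd (Prod.ext h h')
        positivity
      · positivity
    exact_mod_cast this
  have A1 : (u'.1 : ℝ) = u.1 + k * d.1 := by exact_mod_cast a1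
  have A2 : (u'.2 : ℝ) = u.2 + k * d.2 := by exact_mod_cast a2
  have B1 : (z.1 : ℝ) = y.1 + l * d.1 := by exact_mod_cast b1
  have B2 : (z.2 : ℝ) = y.2 + l * d.2 := by exact_mod_cast b2
  have C1 : 2 * (y.1 : ℝ) = 2 * u.1 + s * d.1 - t * d.2 := by exact_mod_cast c1
  have C2 : 2 * (y.2 : ℝ) = 2 * u.2 + s * d.2 + t * d.1 := by exact_mod_cast c2
  have KS : (k : ℝ) = l + s := by exact_mod_cast hks
  have hk' : (0:ℝ) < k := by exact_mod_cast hk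
  have ht' : (0:ℝ) < t := by exact_mod_cast ht
  have y1 : (y.1 : ℝ) = u.1 + (s * d.1 - t * d.2) / 2 := by linarith
  have y2 : (y.2 : ℝ) = u.2 + (s * d.2 + t * d.1) / 2 := by linarith
  obtain ⟨σ, hσ⟩ : ∃ σ : ℝ, 2 * t * σ = l ^ 2 + t ^ 2 - k ^ 2 :=
    ⟨(l ^ 2 + t ^ 2 - k ^ 2) / (2 * t), by field_simp⟩
  refine ⟨?_, ⟨!₂[u.1 + (k * d.1 - σ * d.2) / 2, u.2 + (k * d.2 + σ * d.1) / 2],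
    Real.sqrt ((k ^ 2 + σ ^ 2) / 4 * (d.1 ^ 2 + d.2 ^ 2)), by positivity, ?_⟩,
    EuclideanGeometry.reflection
      (AffineSubspace.mk' !₂[u.1 + k * d.1 / 2, u.2 + k * d.2 / 2]
        (Submodule.span ℝ {!₂[-(d.2 : ℝ), (d.1 : ℝ)]})), ⟨_, ?_, fun x =>
          EuclideanGeometry.reflection_eq_self_iff x⟩, ?_⟩
  · rw [Set.ncard_image_of_injective _ io_inj, Set.ncard_coe_finset]
    rw [Finset.card_insert_of_notMem, Finset.card_insert_of_notMem, Finset.card_pair n6] <;>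
      simp [*]
  · rintro _ ⟨p, hp, rfl⟩
    rw [sphere_coord (Real.sqrt_nonneg _), Real.sq_sqrt (by positivity)]
    have hp : p ∈ ({u, u', y, z} : Finset Pt) := hp
    simp only [Finset.mem_insert, Finset.mem_singleton] at hp
    rcases hp with rfl | rfl | rfl | rfl <;> simp
    · ring
    · rw [A1, A2]; ring
    · rw [y1, y2, KS]
      rw [KS] at hσ
      linear_combination (-(d.1 ^ 2 + d.2 ^ 2 : ℝ) / 4) * hσ
    · rw [B1, B2, y1, y2, KS]
      rw [KS] at hσ
      linear_combination (-(d.1 ^ 2 + d.2 ^ 2 : ℝ) / 4) * hσ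
  · rw [AffineSubspace.direction_mk']
    apply finrank_span_singleton
    intro h
    have h0 := congrArg (fun v : Pl => v 0) h
    have h1 := congrArg (fun v : Pl => v 1) h
    simp at h0 h1
    rw [h0, h1] at hdR
    simp at hdR
  · have r1 : ∀ p q : Pt, ((q.1 : ℝ) - p.1) * (-d.2) + (q.2 - p.2) * d.1 = 0 → ∀ c : ℝ,
      ((p.1 : ℝ) + q.1 - 2 * (u.1 + k * d.1 / 2) = c * (-d.2)) →
      ((p.2 : ℝ) + q.2 - 2 * (u.2 + k * d.2 / 2) = c * d.1) →
      EuclideanGeometry.reflection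
      (AffineSubspace.mk' (!₂[(u.1 : ℝ) + k * d.1 / 2, (u.2 : ℝ) + k * d.2 / 2] : Pl)
        (Submodule.span ℝ {(!₂[-(d.2 : ℝ), (d.1 : ℝ)] : Pl)})) (io p) = io q := by
      intro p q h c h0 h1
      exact refl_apply _ _ _ _ (by simpa using h) c (by simpa using h0) (by simpa using h1)
    simp only [Finset.coe_insert, Finset.coe_singleton, Set.image_insert_eq, Set.image_singleton]
    rw [r1 u u' (by rw [A1, A2]; ring) 0 (by rw [A1]; ring) (by rw [A2]; ring),
      r1 u' u (by rw [A1, A2]; ring) 0 (by rw [A1]; ring) (by rw [A2]; ring),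
      r1 y z (by rw [B1, B2]; ring) t (by rw [B1, y1, KS]; ring) (by rw [B2, y2, KS]; ring),
      r1 z y (by rw [B1, B2]; ring) t (by rw [B1, y1, KS]; ring) (by rw [B2, y2, KS]; ring)]
    ext x
    simp only [Set.mem_insert_iff, Set.mem_singleton_iff]
    tauto

lemma mem_grid (n : ℕ) (x : Pl) : x ∈ grid n ↔ ∃ p ∈ box n, io p = x := by
  constructor
  · intro h
    obtain ⟨a, a1, a2, a3⟩ := h 0
    obtain ⟨b, b1, b2, b3⟩ := h 1
    refine ⟨((a : ℤ), (b : ℤ)), ?_, ?_⟩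
    · simp [box]; omega
    · ext i; fin_cases i
      · simp [a3]
      · simp [b3]
  · rintro ⟨p, hp, rfl⟩ i
    simp only [box, Finset.mem_product, Finset.mem_Icc] at hp
    fin_cases i
    · refine ⟨p.1.toNat, by omega, by omega, ?_⟩
      have : ((p.1.toNat : ℤ) : ℝ) = p.1 := by rw [Int.toNat_of_nonneg (by omega)]
      exact (this.symm.trans (Int.cast_natCast _))
    · refine ⟨p.2.toNat, by omega, by omega, ?_⟩
      have : ((p.2.toNat : ℤ) : ℝ) = p.2 := by rw [Int.toNat_of_nonneg (by omega)]
      exact (this.symm.trans (Int.cast_natCast _))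

open Classical in
lemma count_eq (n : ℕ) :
    trapeziumCount n = ((box n).powerset.filter IT).card := by
  unfold trapeziumCount
  have : {Q : Set Pl | Q ⊆ grid n ∧ IsIsoscelesTrapezium Q} =
      (fun Q : Finset Pt => io '' (Q : Set Pt)) '' (((box n).powerset.filter IT : Finset (Finset Pt)) :
        Set (Finset Pt)) := by
    ext Q
    simp only [Set.mem_ofPred_eq, Set.mem_image, Finset.coe_filter, Finset.mem_powerset]
    constructor
    · rintro ⟨h1, h2⟩
      have hQ : io '' (((box n).filter fun p => io p ∈ Q : Finset Pt) : Set Pt) = Q := by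
        ext x
        simp only [Set.mem_image, Finset.coe_filter, Set.mem_ofPred_eq]
        constructor
        · rintro ⟨p, hp, rfl⟩; exact hp.2
        · intro hx
          obtain ⟨p, hp, rfl⟩ := (mem_grid n x).mp (h1 hx)
          exact ⟨p, ⟨hp, hx⟩, rfl⟩
      refine ⟨(box n).filter fun p => io p ∈ Q, ⟨Finset.filter_subset _ _, ?_⟩, hQ⟩
      unfold IT
      rw [hQ]; exact h2
    · rintro ⟨Q, ⟨h1, h2⟩, rfl⟩
      refine ⟨?_, h2⟩
      rintro _ ⟨p, hp, rfl⟩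
      exact (mem_grid n _).mpr ⟨p, h1 hp, rfl⟩
  rw [this, Set.ncard_image_of_injective, Set.ncard_coe_finset]
  intro P Q h
  exact Finset.coe_injective (io_inj.image_injective h)

end ITrap

namespace ITrap

/-- cross product -/
def cr (p q : Pt) : ℤ := p.1 * q.2 - p.2 * q.1
/-- dot product -/
def dt (p q : Pt) : ℤ := p.1 * q.1 + p.2 * q.2

/-- an oriented labelling -/
structure Good (a b c e : Pt) : Prop where
  ab : a ≠ b
  ac : a ≠ c
  ae : a ≠ e
  bc : b ≠ c
  be : b ≠ e
  ce : c ≠ e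
  h1 : cr (b - a) (e - c) = 0
  h2 : cr (c - a) (e - b) ≠ 0
  h3 : cr (e - a) (c - b) ≠ 0
  h4 : 0 < dt (b - a) (e - c)
  h5 : 0 < cr (b - a) (c - a)
  h6 : dt (e - c) (e - c) < dt (b - a) (b - a)

set_option maxHeartbeats 1000000 in
lemma Good_unique {a b c e a' b' c' e' : Pt} (h : Good a b c e) (h' : Good a' b' c' e')
    (hs : ({a, b, c, e} : Finset Pt) = {a', b', c', e'}) : a = a' ∧ b = b' ∧ c = c' ∧ e = e' := by
  have ma : a' ∈ ({a, b, c, e} : Finset Pt) := by rw [hs]; simp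
  have mb : b' ∈ ({a, b, c, e} : Finset Pt) := by rw [hs]; simp
  have mc : c' ∈ ({a, b, c, e} : Finset Pt) := by rw [hs]; simp
  have me : e' ∈ ({a, b, c, e} : Finset Pt) := by rw [hs]; simp
  clear hs
  simp only [Finset.mem_insert, Finset.mem_singleton] at ma mb mc me
  obtain ⟨ab, ac, ae, bc, be, ce, h1, h2, h3, h4, h5, h6⟩ := h
  obtain ⟨ab', ac', ae', bc', be', ce', h1', -, -, h4', h5', h6'⟩ := h'
  rcases ma with rfl | rfl | rfl | rfl <;> rcases mb with rfl | rfl | rfl | rfl <;>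
    first
    | exact absurd rfl ab'
    | (rcases mc with rfl | rfl | rfl | rfl <;>
        first
        | exact absurd rfl ac'
        | exact absurd rfl bc'
        | (rcases me with rfl | rfl | rfl | rfl <;>
            first
            | exact absurd rfl ae'
            | exact absurd rfl be'
            | exact absurd rfl ce'
            | exact ⟨rfl, rfl, rfl, rfl⟩
            | (exfalso
               simp only [cr, dt, Prod.fst_sub, Prod.snd_sub] at h1 h2 h3 h4 h5 h6 h1' h4' h5' h6'
               first
               | linarith
               | exact h2 (by linarith)
               | exact h3 (by linarith))))

/-- the trapezium with given parameters -/
def TT (x d : Pt) (s t l : ℤ) : Finset Pt :=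
  {x, x + (l + s) • d, x + off d s t, x + off d s t + l • d}

/-- the kite with given parameters -/
def KT (x d : Pt) (k s : ℤ) : Finset Pt :=
  {x, x + k • d, x + off d k s, x + off d k (-(k * k) / s)}

lemma prim_sq {d : Pt} (hd : Int.gcd d.1 d.2 = 1) : 0 < d.1 * d.1 + d.2 * d.2 := by
  rcases eq_or_ne d.1 0 with h | h
  · have : d.2 ≠ 0 := by rintro h'; rw [h, h'] at hd; simp at hd
    have := mul_self_pos.mpr this
    have := mul_self_nonneg d.1
    omega
  · have := mul_self_pos.mpr h
    have := mul_self_nonneg d.2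
    omega

lemma TT_good {d : Pt} (hd : Int.gcd d.1 d.2 = 1) {s t l : ℤ} (hs : 0 < s) (ht : 0 < t) (hl : 0 < l)
    (o1 : 2 * (off d s t).1 = s * d.1 - t * d.2) (o2 : 2 * (off d s t).2 = s * d.2 + t * d.1)
    (x : Pt) :
    Good x (x + (l + s) • d) (x + off d s t) (x + off d s t + l • d) := by
  have hD := prim_sq hd
  obtain ⟨u, v⟩ := x
  obtain ⟨a, b⟩ := d
  generalize off (a, b) s t = o at o1 o2
  obtain ⟨p, q⟩ := o
  simp only at o1 o2 hD
  have htD : 0 < t * (a * a + b * b) := by positivity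
  have hlD : 0 < l * (a * a + b * b) := by positivity
  have hkD : 0 < (l + s) * (a * a + b * b) := by positivity
  have c1 : 2 * (a * q - b * p) = t * (a * a + b * b) := by linear_combination a * o2 - b * o1
  -- distinctness from cross products
  have cz : 0 < a * q - b * p := by linarith
  constructor
  · intro h; simp [Prod.ext_iff] at h
    rcases h.1 with h' | h'
    · omega
    · rcases h.2 with h'' | h''
      · omega
      · simp [h', h''] at hD
  · intro h; simp [Prod.ext_iff] at h; simp [h.1, h.2] at cz
  · intro h; simp [Prod.ext_iff, add_assoc] at h
    have : a * q - b * p = 0 := by linear_combination a * h.2 - b * h.1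
    omega
  · intro h; simp [Prod.ext_iff] at h
    have : a * q - b * p = 0 := by linear_combination b * h.1 - a * h.2
    omega
  · intro h; simp [Prod.ext_iff, add_assoc] at h
    have : a * q - b * p = 0 := by linear_combination b * h.1 - a * h.2
    omega
  · intro h; simp [Prod.ext_iff] at h
    rcases h.1 with h' | h'
    · omega
    · rcases h.2 with h'' | h''
      · omega
      · simp [h', h''] at hD
  all_goals simp only [cr, dt, Prod.fst_sub, Prod.snd_sub, Prod.fst_add, Prod.snd_add, Prod.smul_mk,
      smul_eq_mul]
  · ring
  · have : 0 < s * (t * (a * a + b * b)) := by positivity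
    intro h
    have e : 2 * ((u + p - u) * (v + q + l * b - (v + (l + s) * b)) -
      (v + q - v) * (u + p + l * a - (u + (l + s) * a))) = s * (t * (a * a + b * b)) := by
      linear_combination s * c1
    rw [h] at e
    omega
  · have : 0 < (s + 2 * l) * (t * (a * a + b * b)) := by positivity
    intro h
    have e : 2 * ((u + p + l * a - u) * (v + q - (v + (l + s) * b)) -
      (v + q + l * b - v) * (u + p - (u + (l + s) * a))) = (s + 2 * l) * (t * (a * a + b * b)) := by
      linear_combination (s + 2 * l) * c1
    rw [h] at e
    omega
  · have : 0 < (l + s) * (l * (a * a + b * b)) := by positivity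
    linarith
  · have : 0 < (l + s) * (a * q - b * p) := by positivity
    linarith
  · have : 0 < (2 * l + s) * s * (a * a + b * b) := by positivity
    linarith

lemma prim_mul {d v : Pt} (hd : Int.gcd d.1 d.2 = 1) (h : cr d v = 0) : ∃ m : ℤ, v = m • d := by
  obtain ⟨a, b, hab⟩ := Int.isCoprime_iff_gcd_eq_one.mpr hd
  unfold cr at h
  refine ⟨a * v.1 + b * v.2, Prod.ext ?_ ?_⟩
  · simp only [Prod.smul_fst, smul_eq_mul]; linear_combination -v.1 * hab - b * h
  · simp only [Prod.smul_snd, smul_eq_mul]; linear_combination -v.2 * hab + a * h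

lemma TT_inj {d d' : Pt} (hd : Int.gcd d.1 d.2 = 1) (hd' : Int.gcd d'.1 d'.2 = 1)
    {s t l s' t' l' : ℤ}
    (hs : 0 < s) (ht : 0 < t) (hl : 0 < l) (hs' : 0 < s') (ht' : 0 < t') (hl' : 0 < l')
    (o1 : 2 * (off d s t).1 = s * d.1 - t * d.2) (o2 : 2 * (off d s t).2 = s * d.2 + t * d.1)
    (o1' : 2 * (off d' s' t').1 = s' * d'.1 - t' * d'.2)
    (o2' : 2 * (off d' s' t').2 = s' * d'.2 + t' * d'.1) {x x' : Pt}
    (h : TT x d s t l = TT x' d' s' t' l') : d = d' ∧ s = s' ∧ t = t' ∧ l = l' ∧ x = x' := by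
  obtain ⟨rfl, h2, h3, h4⟩ := Good_unique (TT_good hd hs ht hl o1 o2 x)
    (TT_good hd' hs' ht' hl' o1' o2' x') h
  have hD := prim_sq hd
  rw [h3] at h4
  have h2 := add_left_cancel h2
  have h3 := add_left_cancel h3
  have h4 := add_left_cancel h4
  have h21 := congrArg Prod.fst h2
  have h22 := congrArg Prod.snd h2
  simp only [Prod.smul_fst, Prod.smul_snd, smul_eq_mul] at h21 h22
  have hc : cr d d' = 0 := by
    have : (l' + s') * cr d d' = 0 := by unfold cr; linear_combination d.2 * h21 - d.1 * h22
    rcases mul_eq_zero.mp this with h | h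
    · omega
    · exact h
  obtain ⟨m, hm⟩ := prim_mul hd hc
  have hm1 : m = 1 := by
    rw [hm] at hd' h21 h22
    simp only [Prod.smul_fst, Prod.smul_snd, smul_eq_mul] at hd' h21 h22
    rw [Int.gcd_mul_left, hd, mul_one] at hd'
    have : ((l + s) - (l' + s') * m) * (d.1 * d.1 + d.2 * d.2) = 0 := by
      linear_combination d.1 * h21 + d.2 * h22
    rcases mul_eq_zero.mp this with h | h
    · have : 0 < m := by
        by_contra hc
        have : (l' + s') * m ≤ 0 := mul_nonpos_of_nonneg_of_nonpos (by omega) (by omega)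
        omega
      omega
    · omega
  rw [hm1, one_smul] at hm
  subst hm
  have h41 := congrArg Prod.fst h4
  have h42 := congrArg Prod.snd h4
  simp only [Prod.smul_fst, Prod.smul_snd, smul_eq_mul] at h41 h42
  have canc : ∀ z w : ℤ, (z - w) * (d'.1 * d'.1 + d'.2 * d'.2) = 0 → z = w := by
    intro z w h
    rcases mul_eq_zero.mp h with h | h <;> omega
  have el : l = l' := canc _ _ (by linear_combination d'.1 * h41 + d'.2 * h42)
  subst el
  rw [h3] at o1 o2
  have es : s = s' := canc _ _ (by linear_combination d'.1 * h21 + d'.2 * h22)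
  subst es
  refine ⟨rfl, rfl, canc _ _ ?_, rfl, rfl⟩
  linear_combination d'.1 * (o2' - o2) - d'.2 * (o1' - o1)

lemma TT_IT {d : Pt} (hd : Int.gcd d.1 d.2 = 1) {s t l : ℤ} (hs : 0 < s) (ht : 0 < t) (hl : 0 < l)
    (o1 : 2 * (off d s t).1 = s * d.1 - t * d.2) (o2 : 2 * (off d s t).2 = s * d.2 + t * d.1)
    (x : Pt) : IT (TT x d s t l) := by
  obtain ⟨ab, ac, ae, bc, be, ce, -, -, -, -, -, -⟩ := TT_good hd hs ht hl o1 o2 x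
  refine IT_of x _ _ _ d (l + s) l s t ?_ (by omega) ht rfl ab ac ae bc be ce ?_ ?_ ?_ ?_ ?_ ?_
  · rintro rfl; simp at hd
  all_goals simp
  · linarith
  · linarith

end ITrap

namespace ITrap

lemma TT_of (u y d : Pt) (s t : ℤ) (c1 : 2 * y.1 = 2 * u.1 + (s * d.1 - t * d.2))
    (c2 : 2 * y.2 = 2 * u.2 + (s * d.2 + t * d.1)) :
    2 * (off d s t).1 = s * d.1 - t * d.2 ∧ 2 * (off d s t).2 = s * d.2 + t * d.1 ∧
    u + off d s t = y := by
  refine ⟨?_, ?_, Prod.ext ?_ ?_⟩ <;> simp only [off, Prod.fst_add, Prod.snd_add] <;> omega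

/-- nondegenerate parameters -/
def PA (Q : Finset Pt) (x d : Pt) (s t l : ℤ) : Prop :=
  0 ≤ s ∧ 0 < t ∧ 0 < l ∧ 2 * (off d s t).1 = s * d.1 - t * d.2 ∧
    2 * (off d s t).2 = s * d.2 + t * d.1 ∧ Q = TT x d s t l

lemma typeA0 (u y d : Pt) (hd : Int.gcd d.1 d.2 = 1) (k l t : ℤ) (hkl : l ≤ k) (hl : 0 < l)
    (ht : 0 < t) (c1 : 2 * y.1 = 2 * u.1 + ((k - l) * d.1 - t * d.2))
    (c2 : 2 * y.2 = 2 * u.2 + ((k - l) * d.2 + t * d.1)) :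
    ∃ x d' s' t' l', Int.gcd d'.1 d'.2 = 1 ∧ PA {u, u + k • d, y, y + l • d} x d' s' t' l' := by
  obtain ⟨o1, o2, o3⟩ := TT_of u y d (k - l) t c1 c2
  refine ⟨u, d, k - l, t, l, hd, by omega, ht, hl, o1, o2, ?_⟩
  unfold TT
  rw [o3, add_sub_cancel]

lemma typeA1 (u y d : Pt) (hd : Int.gcd d.1 d.2 = 1) (k l t : ℤ) (hk : 0 < k) (hl : 0 < l)
    (ht : 0 < t) (c1 : 2 * y.1 = 2 * u.1 + ((k - l) * d.1 - t * d.2))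
    (c2 : 2 * y.2 = 2 * u.2 + ((k - l) * d.2 + t * d.1)) :
    ∃ x d' s' t' l', Int.gcd d'.1 d'.2 = 1 ∧ PA {u, u + k • d, y, y + l • d} x d' s' t' l' := by
  rcases le_total l k with h | h
  · exact typeA0 u y d hd k l t h hl ht c1 c2
  · have := typeA0 (y + l • d) (u + k • d) (-d) (by simpa using hd) l k t h hk ht
      (by simp; linear_combination -c1) (by simp; linear_combination -c2)
    have e : ({u, u + k • d, y, y + l • d} : Finset Pt) =
        {y + l • d, y + l • d + l • -d, u + k • d, u + k • d + k • -d} := by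
      simp only [smul_neg, add_neg_cancel_right]
      ext x; simp only [Finset.mem_insert, Finset.mem_singleton]; tauto
    rw [e]; exact this

lemma typeA2 (u y d : Pt) (hd : Int.gcd d.1 d.2 = 1) (k l t : ℤ) (hk : 0 < k) (hl : 0 < l)
    (ht : t ≠ 0) (c1 : 2 * y.1 = 2 * u.1 + ((k - l) * d.1 - t * d.2))
    (c2 : 2 * y.2 = 2 * u.2 + ((k - l) * d.2 + t * d.1)) :
    ∃ x d' s' t' l', Int.gcd d'.1 d'.2 = 1 ∧ PA {u, u + k • d, y, y + l • d} x d' s' t' l' := by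
  rcases lt_or_gt_of_ne ht with h | h
  · have := typeA1 (u + k • d) (y + l • d) (-d) (by simpa using hd) k l (-t) hk hl (by omega)
      (by simp; linear_combination c1) (by simp; linear_combination c2)
    have e : ({u, u + k • d, y, y + l • d} : Finset Pt) =
        {u + k • d, u + k • d + k • -d, y + l • d, y + l • d + l • -d} := by
      simp only [smul_neg, add_neg_cancel_right]
      ext x; simp only [Finset.mem_insert, Finset.mem_singleton]; tauto
    rw [e]; exact this
  · exact typeA1 u y d hd k l t hk hl h c1 c2

lemma typeA3 (u y d : Pt) (hd : Int.gcd d.1 d.2 = 1) (k l t : ℤ) (hk : 0 < k) (hl : l ≠ 0)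
    (ht : t ≠ 0) (c1 : 2 * y.1 = 2 * u.1 + ((k - l) * d.1 - t * d.2))
    (c2 : 2 * y.2 = 2 * u.2 + ((k - l) * d.2 + t * d.1)) :
    ∃ x d' s' t' l', Int.gcd d'.1 d'.2 = 1 ∧ PA {u, u + k • d, y, y + l • d} x d' s' t' l' := by
  rcases lt_or_gt_of_ne hl with h | h
  · have := typeA2 u (y + l • d) d hd k (-l) t hk (by omega) ht
      (by simp; linear_combination c1) (by simp; linear_combination c2)
    have e : ({u, u + k • d, y, y + l • d} : Finset Pt) =
        {u, u + k • d, y + l • d, y + l • d + (-l) • d} := by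
      simp only [neg_smul, add_neg_cancel_right]
      ext x; simp only [Finset.mem_insert, Finset.mem_singleton]; tauto
    rw [e]; exact this
  · exact typeA2 u y d hd k l t hk h ht c1 c2

lemma exists_prim (w : Pt) (hw : w ≠ 0) :
    ∃ (k : ℤ) (d : Pt), 0 < k ∧ Int.gcd d.1 d.2 = 1 ∧ w = k • d := by
  have hg : 0 < Int.gcd w.1 w.2 := by
    rw [Int.gcd_pos_iff]
    by_contra hc; push Not at hc
    exact hw (Prod.ext hc.1 hc.2)
  obtain ⟨a, b, hab, ha, hb⟩ := Int.exists_gcd_one hg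
  exact ⟨Int.gcd w.1 w.2, (a, b), by exact_mod_cast hg, hab, Prod.ext (by simp; linarith) (by simp; linarith)⟩

lemma classify (Q : Finset Pt) (h : IT Q) :
    ∃ x d : Pt, Int.gcd d.1 d.2 = 1 ∧ ((∃ s t l, PA Q x d s t l) ∨
      ∃ k s : ℤ, 0 < k ∧ 2 * (off d k s).1 = k * d.1 - s * d.2 ∧
        2 * (off d k s).2 = k * d.2 + s * d.1 ∧ Q = KT x d k s) := by
  obtain ⟨u, u', y, z, hQ, n1, n2, n3, n4, n5, n6, ⟨a, b, R, hc⟩, hh⟩ := structZ Q h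
  obtain ⟨k, d, hk, hd, hw⟩ := exists_prim (u' - u) (sub_ne_zero.mpr n1.symm)
  have hu' : u' = u + k • d := by rw [← hw]; abel
  have w1 : u'.1 = u.1 + k * d.1 := by rw [hu']; simp
  have w2 : u'.2 = u.2 + k * d.2 := by rw [hu']; simp
  have hD := prim_sq hd
  have cu := hc u (by rw [hQ]; simp)
  have cu' := hc u' (by rw [hQ]; simp)
  have cy := hc y (by rw [hQ]; simp)
  have cz := hc z (by rw [hQ]; simp)
  have W1 : (u'.1 : ℝ) = u.1 + k * d.1 := by exact_mod_cast w1
  have W2 : (u'.2 : ℝ) = u.2 + k * d.2 := by exact_mod_cast w2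
  have hk' : (k : ℝ) ≠ 0 := by exact_mod_cast hk.ne'
  have hDR : (0 : ℝ) < d.1 * d.1 + d.2 * d.2 := by exact_mod_cast hD
  -- center on the bisector
  have bis : (d.1 : ℝ) * (2 * u.1 + k * d.1 - 2 * a) + d.2 * (2 * u.2 + k * d.2 - 2 * b) = 0 := by
    rw [W1, W2] at cu'
    have : (k : ℝ) * ((d.1 : ℝ) * (2 * u.1 + k * d.1 - 2 * a) + d.2 * (2 * u.2 + k * d.2 - 2 * b)) = 0 := by
      linear_combination cu' - cu
    exact (mul_eq_zero.mp this).resolve_left hk'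
  -- perpendicular vectors
  have perp : ∀ v1 v2 : ℤ, (u'.1 - u.1) * v1 + (u'.2 - u.2) * v2 = 0 →
      ∃ t : ℤ, v1 = - t * d.2 ∧ v2 = t * d.1 := by
    intro v1 v2 hv
    rw [w1, w2] at hv
    have : k * cr d (v2, -v1) = 0 := by unfold cr; linear_combination -hv
    have := (mul_eq_zero.mp this).resolve_left hk.ne'
    obtain ⟨m, hm⟩ := prim_mul hd this
    have m1 := congrArg Prod.fst hm
    have m2 := congrArg Prod.snd hm
    simp at m1 m2
    exact ⟨m, by linarith, m1⟩
  rcases hh with ⟨A1, A2⟩ | ⟨B1, B2⟩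
  · -- parallel sides
    have : k * cr d (z - y) = 0 := by
      unfold cr; rw [w1, w2] at A1; simp only [Prod.fst_sub, Prod.snd_sub]; linear_combination A1
    have := (mul_eq_zero.mp this).resolve_left hk.ne'
    obtain ⟨l, hl⟩ := prim_mul hd this
    have hz : z = y + l • d := by rw [← hl]; abel
    have z1 : z.1 = y.1 + l * d.1 := by rw [hz]; simp
    have z2 : z.2 = y.2 + l * d.2 := by rw [hz]; simp
    have hl0 : l ≠ 0 := by rintro rfl; apply n6; rw [hz]; simp
    obtain ⟨t, t1, t2⟩ := perp _ _ A2
    rw [w1, z1] at t1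
    rw [w2, z2] at t2
    have c1 : 2 * y.1 = 2 * u.1 + ((k - l) * d.1 - t * d.2) := by linear_combination t1
    have c2 : 2 * y.2 = 2 * u.2 + ((k - l) * d.2 + t * d.1) := by linear_combination t2
    have ht : t ≠ 0 := by
      rintro rfl
      have y1 : (2 : ℝ) * y.1 = 2 * u.1 + ((k - l) * d.1 - 0 * d.2) := by exact_mod_cast c1
      have y2 : (2 : ℝ) * y.2 = 2 * u.2 + ((k - l) * d.2 + 0 * d.1) := by exact_mod_cast c2
      have y1 : (y.1 : ℝ) = u.1 + (k - l) * d.1 / 2 := by linarith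
      have y2 : (y.2 : ℝ) = u.2 + (k - l) * d.2 / 2 := by linarith
      rw [y1, y2] at cy
      have : ((k : ℝ) - l) * ((k + l) * (d.1 * d.1 + d.2 * d.2)) = 0 := by
        linear_combination 4 * cu - 4 * cy + 2 * (k - l) * bis
      have : (k - l) * ((k + l) * (d.1 * d.1 + d.2 * d.2)) = 0 := by exact_mod_cast this
      rcases mul_eq_zero.mp this with h | h
      · rw [h] at c1 c2
        exact n2 (Prod.ext (by omega) (by omega))
      · have h : k + l = 0 := (mul_eq_zero.mp h).resolve_right hD.ne'
        have h : l = -k := by omega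
        rw [h] at c1 c2
        exact n4 (Prod.ext (by rw [w1]; linarith) (by rw [w2]; linarith))
    obtain ⟨x, d', s, t, l, g, hPA⟩ := typeA3 u y d hd k l t hk hl0 ht c1 c2
    rw [← hu', ← hz, ← hQ] at hPA
    exact ⟨x, d', g, Or.inl ⟨s, t, l, hPA⟩⟩
  · -- kite
    obtain ⟨s, s1, s2⟩ := perp _ _ B1
    obtain ⟨r, r1, r2⟩ := perp _ _ B2
    rw [w1] at s1 r1
    rw [w2] at s2 r2
    obtain ⟨o1, o2, o3⟩ := TT_of u y d k s (by linarith) (by linarith)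
    obtain ⟨p1, p2, p3⟩ := TT_of u z d k r (by linarith) (by linarith)
    have S1 : (2 : ℝ) * y.1 - u.1 - (u.1 + k * d.1) = -s * d.2 := by exact_mod_cast s1
    have S2 : (2 : ℝ) * y.2 - u.2 - (u.2 + k * d.2) = s * d.1 := by exact_mod_cast s2
    have R1 : (2 : ℝ) * z.1 - u.1 - (u.1 + k * d.1) = -r * d.2 := by exact_mod_cast r1
    have R2 : (2 : ℝ) * z.2 - u.2 - (u.2 + k * d.2) = r * d.1 := by exact_mod_cast r2
    have Y1 : (y.1 : ℝ) = u.1 + (k * d.1 - s * d.2) / 2 := by linarith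
    have Y2 : (y.2 : ℝ) = u.2 + (k * d.2 + s * d.1) / 2 := by linarith
    have Z1 : (z.1 : ℝ) = u.1 + (k * d.1 - r * d.2) / 2 := by linarith
    have Z2 : (z.2 : ℝ) = u.2 + (k * d.2 + r * d.1) / 2 := by linarith
    obtain ⟨σ, hσ⟩ : ∃ σ : ℝ, σ = (-(d.2 : ℝ) * (2 * u.1 + k * d.1 - 2 * a) +
      d.1 * (2 * u.2 + k * d.2 - 2 * b)) := ⟨_, rfl⟩
    rw [Y1, Y2] at cy
    rw [Z1, Z2] at cz
    have q1 : ((s : ℝ) ^ 2 - k ^ 2) * (d.1 * d.1 + d.2 * d.2) + 2 * s * σ = 0 := by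
      rw [hσ]; linear_combination 4 * (cy - cu) - 2 * k * bis
    have q2 : ((r : ℝ) ^ 2 - k ^ 2) * (d.1 * d.1 + d.2 * d.2) + 2 * r * σ = 0 := by
      rw [hσ]; linear_combination 4 * (cz - cu) - 2 * k * bis
    have hsr : s ≠ r := by
      rintro rfl
      apply n6
      rw [← o3, ← p3]
    have hsr' : (s : ℝ) - r ≠ 0 := by
      rw [sub_ne_zero]; exact_mod_cast hsr
    have q3 : (s : ℝ) * r + k * k = 0 := by
      have : ((s : ℝ) - r) * ((s * r + k * k) * (d.1 * d.1 + d.2 * d.2)) = 0 := by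
        linear_combination r * q1 - s * q2
      have := (mul_eq_zero.mp this).resolve_left hsr'
      exact (mul_eq_zero.mp this).resolve_right hDR.ne'
    have q4 : s * r + k * k = 0 := by exact_mod_cast q3
    have hs0 : s ≠ 0 := by
      rintro rfl
      have := mul_pos hk hk
      omega
    have hr : -(k * k) / s = r := Int.ediv_eq_of_eq_mul_right hs0 (by linarith)
    refine ⟨u, d, hd, Or.inr ⟨k, s, hk, o1, o2, ?_⟩⟩
    unfold KT
    rw [hr, o3, p3, ← hu', hQ]

end ITrap

namespace ITrap

lemma par_le (d : Pt) : par d ≤ 2 := by unfold par; split_ifs <;> omega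

lemma off_par {d : Pt} {e : ℕ} (he : e < par d) (j i : ℕ) :
    2 * (off d (2 * (j + 1) - e) (2 * (i + 1) - e)).1 =
      (2 * (j + 1) - e) * d.1 - (2 * (i + 1) - e) * d.2 ∧
    2 * (off d (2 * (j + 1) - e) (2 * (i + 1) - e)).2 =
      (2 * (j + 1) - e) * d.2 + (2 * (i + 1) - e) * d.1 := by
  have he2 : e ≤ 1 := by unfold par at he; split_ifs at he <;> omega
  have hpar : e = 1 → d.1 % 2 = 1 ∧ d.2 % 2 = 1 := by
    intro h; by_contra hc; unfold par at he; rw [if_neg hc] at he; omega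
  have hd : 2 ∣ (2 * (j + 1) - e : ℤ) * d.1 - (2 * (i + 1) - e) * d.2 ∧
      2 ∣ (2 * (j + 1) - e : ℤ) * d.2 + (2 * (i + 1) - e) * d.1 := by
    rcases Nat.le_one_iff_eq_zero_or_eq_one.mp he2 with h | h
    · subst h
      constructor
      · exact ⟨(j + 1) * d.1 - (i + 1) * d.2, by push_cast; ring⟩
      · exact ⟨(j + 1) * d.2 + (i + 1) * d.1, by push_cast; ring⟩
    · obtain ⟨p1, p2⟩ := hpar h
      obtain ⟨u, hu⟩ : ∃ u, d.1 = 2 * u + 1 := ⟨d.1 / 2, by omega⟩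
      obtain ⟨v, hv⟩ : ∃ v, d.2 = 2 * v + 1 := ⟨d.2 / 2, by omega⟩
      subst h
      rw [hu, hv]
      constructor
      · exact ⟨(2 * j + 1) * u - (2 * i + 1) * v + j - i, by push_cast; ring⟩
      · exact ⟨(2 * j + 1) * v + (2 * i + 1) * u + j + i + 1, by push_cast; ring⟩
  exact ⟨Int.mul_ediv_cancel' hd.1, Int.mul_ediv_cancel' hd.2⟩

lemma exists_par {d : Pt} (hd : Int.gcd d.1 d.2 = 1) {s t : ℤ} (hs : 0 < s) (ht : 0 < t)
    (o1 : 2 * (off d s t).1 = s * d.1 - t * d.2) (o2 : 2 * (off d s t).2 = s * d.2 + t * d.1) :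
    ∃ e j i : ℕ, e < par d ∧ s = 2 * (j + 1) - e ∧ t = 2 * (i + 1) - e := by
  have e1 : Even (s * d.1 - t * d.2) := ⟨(off d s t).1, by omega⟩
  have e2 : Even (s * d.2 + t * d.1) := ⟨(off d s t).2, by omega⟩
  rw [Int.even_sub, Int.even_mul, Int.even_mul] at e1
  rw [Int.even_add, Int.even_mul, Int.even_mul] at e2
  have hne : ¬ (Even d.1 ∧ Even d.2) := by
    rintro ⟨h1, h2⟩
    have := Int.dvd_coe_gcd h1.two_dvd h2.two_dvd
    rw [hd] at this
    norm_num at this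
  by_cases hse : Even s
  · have hte : Even t := by tauto
    obtain ⟨a, ha⟩ := hse
    obtain ⟨b, hb⟩ := hte
    refine ⟨0, (a - 1).toNat, (b - 1).toNat, by unfold par; split_ifs <;> omega, by omega, by omega⟩
  · have hte : ¬ Even t := by tauto
    have h1 : ¬ Even d.1 := by tauto
    have h2 : ¬ Even d.2 := by tauto
    rw [Int.not_even_iff] at hse hte h1 h2
    refine ⟨1, (s / 2).toNat, (t / 2).toNat, ?_, by omega, by omega⟩
    unfold par; rw [if_pos ⟨h1, h2⟩]; omega

/-- primitive directions -/
noncomputable def Dn (n : ℕ) : Finset Pt :=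
  (Finset.Icc (-(n : ℤ)) n ×ˢ Finset.Icc (-(n : ℤ)) n).filter fun d => Int.gcd d.1 d.2 = 1

lemma mem_Dn {n : ℕ} {d : Pt} : d ∈ Dn n ↔ mx d ≤ n ∧ Int.gcd d.1 d.2 = 1 := by
  simp only [Dn, mx, Finset.mem_filter, Finset.mem_product, Finset.mem_Icc]
  constructor
  · rintro ⟨h, h'⟩; exact ⟨by omega, h'⟩
  · rintro ⟨h, h'⟩; exact ⟨by omega, h'⟩

lemma mx_pos {d : Pt} (hd : Int.gcd d.1 d.2 = 1) : 0 < mx d := by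
  by_contra hc
  have h1 : d.1 = 0 := by unfold mx at hc; omega
  have h2 : d.2 = 0 := by unfold mx at hc; omega
  rw [h1, h2] at hd; simp at hd

/-- parameter type -/
abbrev PTy := Σ _ : Pt, Σ _ : ℕ, Σ _ : ℕ, Σ _ : ℕ, Σ _ : ℕ, Pt

/-- all parameters -/
noncomputable def SP (n : ℕ) : Finset PTy :=
  (Dn n).sigma fun d => (Finset.range (par d)).sigma fun e =>
    (Finset.range (n / mx d + 1)).sigma fun j => (Finset.range (n / mx d + 1)).sigma fun i =>
      (Finset.range (n / mx d + 1)).sigma fun l =>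
        XX n d (2 * (j + 1) - e) (2 * (i + 1) - e) (l + 1)

lemma SP_card (n : ℕ) : (SP n).card = ∑ d ∈ Dn n, NN n d := by
  simp only [SP, Finset.card_sigma, NN]

/-- the parametrisation -/
def pmap (p : PTy) : Finset Pt :=
  TT p.2.2.2.2.2 p.1 (2 * (p.2.2.1 + 1) - p.2.1) (2 * (p.2.2.2.1 + 1) - p.2.1) (p.2.2.2.2.1 + 1)

lemma pmap_inj (n : ℕ) : Set.InjOn pmap (SP n : Set PTy) := by
  rintro ⟨d, e, j, i, l, x⟩ hp ⟨d', e', j', i', l', x'⟩ hp' h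
  simp only [SP, Finset.mem_coe, Finset.mem_sigma, Finset.mem_range] at hp hp'
  obtain ⟨hd, he, -⟩ := hp
  obtain ⟨hd', he', -⟩ := hp'
  have a := off_par he j i
  have a' := off_par he' j' i'
  have e2 := par_le d
  have e2' := par_le d'
  unfold pmap at h
  obtain ⟨rfl, h1, h2, h3, rfl⟩ := TT_inj (mem_Dn.mp hd).2 (mem_Dn.mp hd').2 (by omega) (by omega)
    (by omega) (by omega) (by omega) (by omega) a.1 a.2 a'.1 a'.2 h
  simp only at h1 h2 h3
  obtain rfl : e = e' := by omega
  obtain rfl : j = j' := by omega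
  obtain rfl : i = i' := by omega
  obtain rfl : l = l' := by omega
  rfl

open Classical in
lemma pmap_mem (n : ℕ) (p : PTy) (hp : p ∈ SP n) : pmap p ∈ (box n).powerset.filter IT := by
  obtain ⟨d, e, j, i, l, x⟩ := p
  simp only [SP, Finset.mem_sigma, Finset.mem_range] at hp
  obtain ⟨hd, he, -, -, -, hx⟩ := hp
  have a := off_par he j i
  have e2 := par_le d
  rw [Finset.mem_filter, Finset.mem_powerset]
  constructor
  · simp only [XX, Finset.mem_filter] at hx
    intro q hq
    simp only [pmap, TT, Finset.mem_insert, Finset.mem_singleton] at hq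
    rcases hq with rfl | rfl | rfl | rfl
    · exact hx.1
    · exact hx.2.1
    · exact hx.2.2.1
    · exact hx.2.2.2
  · exact TT_IT (mem_Dn.mp hd).2 (by omega) (by omega) (by omega)
      a.1 a.2 x

lemma mul_mx (k : ℤ) (d : Pt) (N : ℕ) (h1 : |k * d.1| ≤ N) (h2 : |k * d.2| ≤ N) :
    k.natAbs * mx d ≤ N := by
  have h1' : k.natAbs * d.1.natAbs ≤ N := by rw [← Int.natAbs_mul]; rw [Int.abs_eq_natAbs] at h1 h2; omega
  have h2' : k.natAbs * d.2.natAbs ≤ N := by rw [← Int.natAbs_mul]; rw [Int.abs_eq_natAbs] at h1 h2; omega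
  unfold mx
  rcases max_cases d.1.natAbs d.2.natAbs with h | h <;> rw [h.1] <;> assumption

lemma box_k {n : ℕ} {x d : Pt} {k : ℤ} (h1 : x ∈ box n) (h2 : x + k • d ∈ box n) :
    k.natAbs * mx d ≤ n := by
  simp only [box, Finset.mem_product, Finset.mem_Icc, Prod.fst_add, Prod.snd_add, Prod.smul_fst,
    Prod.smul_snd, smul_eq_mul] at h1 h2
  apply mul_mx <;> rw [abs_le] <;> omega

lemma box_t {n : ℕ} {x y d p q : Pt} {t : ℤ} (h1 : x ∈ box n) (h2 : y ∈ box n) (h3 : p ∈ box n)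
    (h4 : q ∈ box n) (e1 : x.1 + y.1 - p.1 - q.1 = - (t * d.2))
    (e2 : x.2 + y.2 - p.2 - q.2 = t * d.1) :
    t.natAbs * mx d ≤ 2 * n := by
  simp only [box, Finset.mem_product, Finset.mem_Icc] at h1 h2 h3 h4
  apply mul_mx <;> rw [abs_le] <;> push_cast <;> omega

/-- parameters for the negligible part -/
noncomputable def WW (n : ℕ) : Finset (Σ _ : Pt, Pt × ℤ × ℤ) :=
  (Dn n).sigma fun d => box n ×ˢ
    Finset.Icc (-((2 * n / mx d : ℕ) : ℤ)) ((2 * n / mx d : ℕ) : ℤ) ×ˢ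
    Finset.Icc (-((2 * n / mx d : ℕ) : ℤ)) ((2 * n / mx d : ℕ) : ℤ)

lemma mem_WW {n : ℕ} {d x : Pt} {k t : ℤ} (hd : Int.gcd d.1 d.2 = 1) (hdn : mx d ≤ n)
    (hx : x ∈ box n) (hk : k.natAbs * mx d ≤ 2 * n) (ht : t.natAbs * mx d ≤ 2 * n) :
    (⟨d, x, k, t⟩ : Σ _ : Pt, Pt × ℤ × ℤ) ∈ WW n := by
  have h0 := mx_pos hd
  have := (Nat.le_div_iff_mul_le h0).mpr hk
  have := (Nat.le_div_iff_mul_le h0).mpr ht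
  simp only [WW, Finset.mem_sigma, Finset.mem_product, Finset.mem_Icc]
  refine ⟨mem_Dn.mpr ⟨hdn, hd⟩, hx, ⟨?_, ?_⟩, ?_, ?_⟩ <;> omega

open Classical in
lemma cover (n : ℕ) : (box n).powerset.filter IT ⊆ (SP n).image pmap ∪
    ((WW n).image (fun w => TT w.2.1 w.1 0 w.2.2.2 w.2.2.1) ∪
     (WW n).image (fun w => KT w.2.1 w.1 w.2.2.1 w.2.2.2)) := by
  intro Q hQ
  rw [Finset.mem_filter, Finset.mem_powerset] at hQ
  obtain ⟨hQ, hIT⟩ := hQ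
  obtain ⟨x, d, hd, h⟩ := classify Q hIT
  have h0 := mx_pos hd
  rw [Finset.mem_union, Finset.mem_union]
  rcases h with ⟨s, t, l, hs, ht, hl, o1, o2, rfl⟩ | ⟨k, s, hk, o1, o2, rfl⟩
  · have m1 : x ∈ box n := hQ (by simp [TT])
    have m2 : x + (l + s) • d ∈ box n := hQ (by simp [TT])
    have m3 : x + off d s t ∈ box n := hQ (by simp [TT])
    have m4 : x + off d s t + l • d ∈ box n := hQ (by simp [TT])
    have bk := box_k m1 m2
    have bl := box_k m3 m4
    have bt : t.natAbs * mx d ≤ 2 * n := by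
      refine box_t m3 m4 m1 m2 ?_ ?_ <;>
      simp only [Prod.fst_add, Prod.snd_add, Prod.smul_fst, Prod.smul_snd, smul_eq_mul]
      · linear_combination o1
      · linear_combination o2
    have hdn : mx d ≤ n := le_trans (Nat.le_mul_of_pos_left _ (by omega)) bl
    rcases hs.eq_or_lt with rfl | hs
    · right; left
      exact Finset.mem_image.mpr ⟨⟨d, x, l, t⟩, mem_WW hd hdn m1 (by omega) bt, rfl⟩
    · left
      obtain ⟨e, j, i, he, rfl, rfl⟩ := exists_par hd hs ht o1 o2
      have e2 := par_le d
      rw [Finset.mem_image]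
      refine ⟨⟨d, e, j, i, l.toNat - 1, x⟩, ?_, ?_⟩
      · have kl := (Nat.le_div_iff_mul_le h0).mpr bk
        have ll := (Nat.le_div_iff_mul_le h0).mpr bl
        have it : i ≤ n / mx d := by
          rw [Nat.le_div_iff_mul_le h0]
          have : 2 * i ≤ (2 * ((i : ℤ) + 1) - e).natAbs := by omega
          have := Nat.mul_le_mul_right (mx d) this
          have : 2 * (i * mx d) ≤ 2 * n := by rw [← mul_assoc]; omega
          omega
        simp only [SP, Finset.mem_sigma, Finset.mem_range, XX, Finset.mem_filter]
        have el : ((l.toNat - 1 : ℕ) : ℤ) + 1 = l := by omega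
        rw [el]
        exact ⟨mem_Dn.mpr ⟨hdn, hd⟩, he, by omega, by omega, by omega, m1, m2, m3, m4⟩
      · have el : ((l.toNat - 1 : ℕ) : ℤ) + 1 = l := by omega
        simp only [pmap, el]
  · right; right
    have m1 : x ∈ box n := hQ (by simp [KT])
    have m2 : x + k • d ∈ box n := hQ (by simp [KT])
    have m3 : x + off d k s ∈ box n := hQ (by simp [KT])
    have bk := box_k m1 m2
    have bt : s.natAbs * mx d ≤ 2 * n := by
      refine box_t m3 m3 m1 m2 ?_ ?_ <;>
      simp only [Prod.fst_add, Prod.snd_add, Prod.smul_fst, Prod.smul_snd, smul_eq_mul]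
      · linear_combination o1
      · linear_combination o2
    have hdn : mx d ≤ n := le_trans (Nat.le_mul_of_pos_left _ (by omega)) bk
    exact Finset.mem_image.mpr ⟨⟨d, x, k, s⟩, mem_WW hd hdn m1 (by omega) bt, rfl⟩

lemma count_lower (n : ℕ) : ∑ d ∈ Dn n, NN n d ≤ trapeziumCount n := by
  classical
  rw [count_eq, ← SP_card, ← Finset.card_image_of_injOn (pmap_inj n)]
  apply Finset.card_le_card
  intro Q hQ
  obtain ⟨p, hp, rfl⟩ := Finset.mem_image.mp hQ
  convert pmap_mem n p hp

lemma count_upper (n : ℕ) : trapeziumCount n ≤ ∑ d ∈ Dn n, NN n d + 2 * (WW n).card := by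
  classical
  rw [count_eq, ← SP_card]
  have h := Finset.card_le_card (cover n)
  have h1 := Finset.card_image_le (s := SP n) (f := pmap)
  have h2 := Finset.card_image_le (s := WW n)
    (f := fun w => TT w.2.1 w.1 0 w.2.2.2 w.2.2.1)
  have h3 := Finset.card_image_le (s := WW n)
    (f := fun w => KT w.2.1 w.1 w.2.2.1 w.2.2.2)
  have h4 := h.trans ((Finset.card_union_le _ _).trans (Nat.add_le_add_left (Finset.card_union_le _ _) _))
  have h5 := h4.trans (Nat.add_le_add h1 (Nat.add_le_add h2 h3))
  rw [two_mul]
  convert h5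

lemma WW_card (n : ℕ) : ((WW n).card : ℝ) ≤ 25 * (n : ℝ) ^ 4 * ∑ d ∈ Dn n, 1 / (mx d : ℝ) ^ 2 := by
  rw [WW, Finset.card_sigma, Nat.cast_sum, Finset.mul_sum]
  refine Finset.sum_le_sum fun d hd => ?_
  obtain ⟨h1, h2⟩ := mem_Dn.mp hd
  have h0 := mx_pos h2
  have h0' : (0 : ℝ) < mx d := by exact_mod_cast h0
  have h1' : (mx d : ℝ) ≤ n := by exact_mod_cast h1
  have hB : ((2 * n / mx d : ℕ) : ℝ) ≤ 2 * n / mx d := by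
    have := @Nat.cast_div_le ℝ _ _ _ (2 * n) (mx d)
    simpa using this
  have hone : 1 ≤ (n : ℝ) / mx d := by rw [le_div_iff₀ h0']; linarith
  simp only [box, Finset.card_product, Int.card_Icc]
  generalize hb : 2 * n / mx d = B at hB
  have e1 : ((B : ℤ) + 1 - -(B : ℤ)).toNat = 2 * B + 1 := by omega
  have e2 : ((n : ℤ) + 1 - 1).toNat = n := by omega
  rw [e1, e2]
  push_cast
  have h5 : 2 * (B : ℝ) + 1 ≤ 5 * (n / mx d) := by
    have : 2 * (n : ℝ) / mx d = 2 * (n / mx d) := by ring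
    linarith
  have h6 : (2 * (B : ℝ) + 1) * (2 * B + 1) ≤ (5 * (n / mx d)) * (5 * (n / mx d)) := by gcongr
  calc (n : ℝ) * n * ((2 * (B : ℝ) + 1) * (2 * B + 1))
      ≤ n * n * ((5 * (n / mx d)) * (5 * (n / mx d))) := by gcongr
    _ = _ := by field_simp; norm_num

end ITrap

namespace ITrap

/-- directions of sup norm `a` -/
noncomputable def DD (a : ℕ) : Finset Pt := (Dn a).filter fun d => mx d = a

lemma mem_DD {a : ℕ} {d : Pt} : d ∈ DD a ↔ mx d = a ∧ Int.gcd d.1 d.2 = 1 := by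
  simp only [DD, Finset.mem_filter, mem_Dn]
  constructor
  · rintro ⟨⟨_, h⟩, h'⟩; exact ⟨h', h⟩
  · rintro ⟨h, h'⟩; exact ⟨⟨h.le, h'⟩, h⟩

lemma sum_Dn (n : ℕ) (f : Pt → ℝ) : ∑ d ∈ Dn n, f d = ∑ a ∈ Finset.Icc 1 n, ∑ d ∈ DD a, f d := by
  rw [← Finset.sum_fiberwise_of_maps_to (g := mx) (t := Finset.Icc 1 n)]
  · refine Finset.sum_congr rfl fun a ha => Finset.sum_congr ?_ fun _ _ => rfl
    rw [Finset.mem_Icc] at ha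
    ext d
    rw [Finset.mem_filter, mem_Dn, mem_DD]
    constructor
    · rintro ⟨⟨_, h⟩, h'⟩; exact ⟨h', h⟩
    · rintro ⟨h, h'⟩; exact ⟨⟨h.trans_le ha.2, h'⟩, h⟩
  · intro d hd
    obtain ⟨h1, h2⟩ := mem_Dn.mp hd
    exact Finset.mem_Icc.mpr ⟨mx_pos h2, h1⟩

lemma DD_card (a : ℕ) (ha : 1 ≤ a) : (DD a).card ≤ 12 * a := by
  have hsub : DD a ⊆ ({(a : ℤ), -(a : ℤ)} : Finset ℤ) ×ˢ Finset.Icc (-(a : ℤ)) a ∪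
      Finset.Icc (-(a : ℤ)) a ×ˢ ({(a : ℤ), -(a : ℤ)} : Finset ℤ) := by
    intro d hd
    obtain ⟨h1, -⟩ := mem_DD.mp hd
    simp only [Finset.mem_union, Finset.mem_product, Finset.mem_insert, Finset.mem_singleton,
      Finset.mem_Icc]
    unfold mx at h1
    omega
  refine (Finset.card_le_card hsub).trans ((Finset.card_union_le _ _).trans ?_)
  have h2 : ({(a : ℤ), -(a : ℤ)} : Finset ℤ).card ≤ 2 := Finset.card_le_two
  rw [Finset.card_product, Finset.card_product, Int.card_Icc]
  have e : ((a : ℤ) + 1 - -(a : ℤ)).toNat = 2 * a + 1 := by omega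
  rw [e]
  nlinarith

lemma sum_inv_sq (n : ℕ) : ∑ d ∈ Dn n, 1 / (mx d : ℝ) ^ 2 ≤ 12 * (1 + Real.log n) := by
  rw [sum_Dn]
  have h : ∀ a ∈ Finset.Icc 1 n, ∑ d ∈ DD a, 1 / (mx d : ℝ) ^ 2 ≤ 12 * (a : ℝ)⁻¹ := by
    intro a ha
    have ha := (Finset.mem_Icc.mp ha).1
    have ha' : (0 : ℝ) < a := by exact_mod_cast ha
    have : ∑ d ∈ DD a, 1 / (mx d : ℝ) ^ 2 = (DD a).card * (1 / (a : ℝ) ^ 2) := by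
      rw [← nsmul_eq_mul, ← Finset.sum_const]
      exact Finset.sum_congr rfl fun d hd => by rw [(mem_DD.mp hd).1]
    rw [this]
    have hc : ((DD a).card : ℝ) ≤ 12 * a := by exact_mod_cast DD_card a ha
    calc ((DD a).card : ℝ) * (1 / (a : ℝ) ^ 2) ≤ 12 * a * (1 / (a : ℝ) ^ 2) := by gcongr
      _ = _ := by field_simp
  refine (Finset.sum_le_sum h).trans ?_
  rw [← Finset.mul_sum]
  have := harmonic_le_one_add_log n
  rw [harmonic_eq_sum_Icc] at this
  push_cast at this
  linarith

/-- inner sum -/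
noncomputable def ha (a : ℕ) : ℝ := ∑ b ∈ (Finset.Ico 1 a).filter (fun b => Nat.gcd a b = 1),
    2 * (3 + (-1 : ℝ) ^ (a + b)) * fab a b

lemma gamma_eq : gammaConst = 4 / 15 + ∑' a, ha a := rfl

lemma KK_bound (r : ℝ) (h0 : 0 ≤ r) (h1 : r ≤ 1) : |KK r| ≤ 1 := by
  unfold KK
  have p : ∀ k : ℕ, 0 ≤ r ^ k ∧ r ^ k ≤ 1 := fun k => ⟨by positivity, pow_le_one₀ h0 h1⟩
  have hden : 480 ≤ 480 * (1 + r) ^ 2 * (1 + r ^ 2) := by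
    have : 1 ≤ (1 + r) ^ 2 := by nlinarith
    have h2 : 1 ≤ 1 + r ^ 2 := by nlinarith
    nlinarith
  rw [abs_div, abs_of_pos (by linarith : 0 < 480 * (1 + r) ^ 2 * (1 + r ^ 2)), div_le_one (by linarith)]
  rw [abs_le]
  constructor <;> linarith [p 2, p 3, p 4, p 5, p 6, (p 2).1, (p 2).2, (p 3).1, (p 3).2, (p 4).1,
    (p 4).2, (p 5).1, (p 5).2, (p 6).1, (p 6).2]

lemma gg_bound (d : Pt) : |gg d| ≤ 2 / (mx d : ℝ) ^ 3 := by
  unfold gg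
  have hp : (par d : ℝ) ≤ 2 := by exact_mod_cast par_le d
  have hr : (mn d : ℝ) / mx d ≤ 1 := by
    apply div_le_one_of_le₀ _ (by positivity)
    have : mn d ≤ mx d := min_le_max
    exact_mod_cast this
  have hk := KK_bound _ (by positivity) hr
  rw [abs_div, abs_mul, Nat.abs_cast, abs_of_nonneg (by positivity : (0:ℝ) ≤ (mx d : ℝ) ^ 3)]
  apply div_le_div_of_nonneg_right _ (by positivity)
  calc (par d : ℝ) * |KK (mn d / mx d)| ≤ 2 * 1 := by gcongr
    _ = 2 := by ring

lemma term_eq (a b : ℕ) (hb : 1 ≤ b) (hba : b < a) (hg : Nat.gcd a b = 1) :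
    2 * (3 + (-1 : ℝ) ^ (a + b)) * fab a b = 8 * gg ((a : ℤ), (b : ℤ)) := by
  have ha : (0 : ℝ) < a := by exact_mod_cast (by omega : 0 < a)
  have hb' : (0 : ℝ) < b := by exact_mod_cast hb
  have m1 : mx ((a : ℤ), (b : ℤ)) = a := by simp only [mx, Int.natAbs_natCast]; omega
  have m2 : mn ((a : ℤ), (b : ℤ)) = b := by simp only [mn, Int.natAbs_natCast]; omega
  have hf : fab a b = 2 * KK (b / a) / a ^ 3 := by
    unfold fab KK
    field_simp
    ring
  have hp : (2 : ℝ) * (3 + (-1 : ℝ) ^ (a + b)) = 4 * par ((a : ℤ), (b : ℤ)) := by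
    have hne : ¬ (2 ∣ a ∧ 2 ∣ b) := by
      rintro ⟨h1, h2⟩
      have := Nat.dvd_gcd h1 h2
      rw [hg] at this; norm_num at this
    unfold par
    split_ifs with h
    · simp only at h
      rw [Even.neg_one_pow (by rw [Nat.even_iff]; omega)]; norm_num
    · simp only at h
      rw [Odd.neg_one_pow (by rw [Nat.odd_iff]; omega)]; norm_num
  rw [hp, hf, gg, m1, m2]
  ring

lemma gg_sym (d d' : Pt) (h : (d.1.natAbs = d'.1.natAbs ∧ d.2.natAbs = d'.2.natAbs) ∨
    (d.1.natAbs = d'.2.natAbs ∧ d.2.natAbs = d'.1.natAbs)) : gg d = gg d' := by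
  have m1 : mx d = mx d' := by unfold mx; omega
  have m2 : mn d = mn d' := by unfold mn; omega
  have m3 : par d = par d' := by
    unfold par
    congr 1
    apply propext
    omega
  unfold gg
  rw [m1, m2, m3]

lemma sum_DD (a : ℕ) (h2 : 2 ≤ a) : ∑ d ∈ DD a, gg d = ha a := by
  have h8 : ha a = ∑ p ∈ (({1, -1} : Finset ℤ) ×ˢ ({1, -1} : Finset ℤ) ×ˢ (Finset.univ : Finset Bool)) ×ˢ
      (Finset.Ico 1 a).filter (fun b => Nat.gcd a b = 1), gg ((a : ℤ), (p.2 : ℤ)) := by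
    rw [Finset.sum_product]
    simp only [Finset.sum_const]
    have : (({1, -1} : Finset ℤ) ×ˢ ({1, -1} : Finset ℤ) ×ˢ (Finset.univ : Finset Bool)).card = 8 := by
      rfl
    rw [this, nsmul_eq_mul, ha, Finset.mul_sum]
    refine Finset.sum_congr rfl fun b hb => ?_
    simp only [Finset.mem_filter, Finset.mem_Ico] at hb
    rw [term_eq a b hb.1.1 hb.1.2 hb.2]
    norm_num
  rw [h8]
  symm
  refine Finset.sum_nbij (fun p => if p.1.2.2 then (p.1.1 * a, p.1.2.1 * (p.2 : ℤ)) else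
    (p.1.2.1 * (p.2 : ℤ), p.1.1 * a)) ?_ ?_ ?_ ?_
  · rintro ⟨⟨ε, δ, w⟩, b⟩ hp
    simp only [Finset.mem_product, Finset.mem_insert, Finset.mem_singleton, Finset.mem_filter,
      Finset.mem_Ico] at hp
    obtain ⟨⟨hε, hδ, -⟩, ⟨hb1, hb2⟩, hg⟩ := hp
    rw [mem_DD]
    have hg' : Nat.gcd b a = 1 := by rw [Nat.gcd_comm]; exact hg
    rcases hε with rfl | rfl <;> rcases hδ with rfl | rfl <;> cases w <;>
      simp [mx, hg, hg'] <;> omega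
  · rintro ⟨⟨ε, δ, w⟩, b⟩ hp ⟨⟨ε', δ', w'⟩, b'⟩ hp' h
    simp only [Finset.coe_product, Set.mem_prod, Finset.mem_coe, Finset.mem_insert,
      Finset.mem_singleton, Finset.mem_filter, Finset.mem_Ico] at hp hp'
    obtain ⟨⟨hε, hδ, -⟩, ⟨hb1, hb2⟩, hg⟩ := hp
    obtain ⟨⟨hε', hδ', -⟩, ⟨hb1', hb2'⟩, hg'⟩ := hp'
    rcases hε with rfl | rfl <;> rcases hδ with rfl | rfl <;> cases w <;>
    rcases hε' with rfl | rfl <;> rcases hδ' with rfl | rfl <;> cases w' <;>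
      simp [Prod.ext_iff] at h ⊢ <;> omega
  · rintro ⟨x, y⟩ hd
    rw [Finset.mem_coe, mem_DD] at hd
    obtain ⟨hm, hg⟩ := hd
    simp only [mx] at hm
    have hg1 : Nat.gcd x.natAbs y.natAbs = 1 := hg
    have hne : x.natAbs ≠ y.natAbs := by
      intro h; rw [h, Nat.gcd_self] at hg1; omega
    have hx0 : x.natAbs ≠ 0 := by
      intro h; rw [h, Nat.gcd_zero_left] at hg1; omega
    have hy0 : y.natAbs ≠ 0 := by
      intro h; rw [h, Nat.gcd_zero_right] at hg1; omega
    have sgn : ∀ z : ℤ, z.natAbs ≠ 0 → ∃ ε : ℤ, (ε = 1 ∨ ε = -1) ∧ ε * (z.natAbs : ℤ) = z := by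
      intro z hz
      rcases Int.natAbs_eq z with h | h
      · exact ⟨1, Or.inl rfl, by omega⟩
      · exact ⟨-1, Or.inr rfl, by omega⟩
    obtain ⟨ε, hε, ex⟩ := sgn x hx0
    obtain ⟨δ, hδ, ey⟩ := sgn y hy0
    rcases lt_or_gt_of_ne hne with h | h
    · have hya : y.natAbs = a := by omega
      refine ⟨⟨⟨δ, ε, false⟩, x.natAbs⟩, ?_, ?_⟩
      · simp only [Finset.coe_product, Set.mem_prod, Finset.mem_coe, Finset.mem_insert,
          Finset.mem_singleton, Finset.mem_filter, Finset.mem_Ico, Finset.mem_univ]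
        refine ⟨⟨hδ, hε, trivial⟩, ⟨by omega, by omega⟩, ?_⟩
        rw [← hya, Nat.gcd_comm]; exact hg1
      · simp only [Bool.false_eq_true, if_false]
        rw [ex, ← hya, ey]
    · have hxa : x.natAbs = a := by omega
      refine ⟨⟨⟨ε, δ, true⟩, y.natAbs⟩, ?_, ?_⟩
      · simp only [Finset.coe_product, Set.mem_prod, Finset.mem_coe, Finset.mem_insert,
          Finset.mem_singleton, Finset.mem_filter, Finset.mem_Ico, Finset.mem_univ]
        refine ⟨⟨hε, hδ, trivial⟩, ⟨by omega, by omega⟩, ?_⟩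
        rw [← hxa]; exact hg1
      · simp only [if_true]
        rw [ey, ← hxa, ex]
  · rintro ⟨⟨ε, δ, w⟩, b⟩ hp
    simp only [Finset.mem_product, Finset.mem_insert, Finset.mem_singleton, Finset.mem_filter,
      Finset.mem_Ico] at hp
    obtain ⟨⟨hε, hδ, -⟩, -⟩ := hp
    apply gg_sym
    rcases hε with rfl | rfl <;> rcases hδ with rfl | rfl <;> cases w <;> simp

lemma sum_DD1 : ∑ d ∈ DD 1, gg d = 4 / 15 := by
  have e : DD 1 = {(1, 0), (-1, 0), (0, 1), (0, -1), (1, 1), (1, -1), (-1, 1), (-1, -1)} := by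
    ext ⟨x, y⟩
    rw [mem_DD]
    constructor
    · rintro ⟨h, hg⟩
      simp only [mx] at h
      have hx : x = -1 ∨ x = 0 ∨ x = 1 := by omega
      have hy : y = -1 ∨ y = 0 ∨ y = 1 := by omega
      rcases hx with rfl | rfl | rfl <;> rcases hy with rfl | rfl | rfl <;> simp at h ⊢
    · intro h
      simp only [Finset.mem_insert, Finset.mem_singleton, Prod.mk.injEq] at h
      rcases h with ⟨rfl, rfl⟩ | ⟨rfl, rfl⟩ | ⟨rfl, rfl⟩ | ⟨rfl, rfl⟩ | ⟨rfl, rfl⟩ | ⟨rfl, rfl⟩ |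
        ⟨rfl, rfl⟩ | ⟨rfl, rfl⟩ <;> decide
  have g0 : gg (1, 0) = 1 / 24 := by norm_num [gg, par, mx, mn, KK]
  have g1 : gg (1, 1) = 1 / 40 := by norm_num [gg, par, mx, mn, KK]
  rw [e]
  rw [Finset.sum_insert (by decide), Finset.sum_insert (by decide), Finset.sum_insert (by decide),
    Finset.sum_insert (by decide), Finset.sum_insert (by decide), Finset.sum_insert (by decide),
    Finset.sum_insert (by decide), Finset.sum_singleton]
  rw [gg_sym (-1, 0) (1, 0) (by decide), gg_sym (0, 1) (1, 0) (by decide),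
    gg_sym (0, -1) (1, 0) (by decide), gg_sym (1, -1) (1, 1) (by decide),
    gg_sym (-1, 1) (1, 1) (by decide), gg_sym (-1, -1) (1, 1) (by decide), g0, g1]
  norm_num

lemma ha_zero (a : ℕ) (h : a ≤ 1) : ha a = 0 := by
  unfold ha
  rw [Finset.Ico_eq_empty (by omega)]
  simp

lemma sum_gg (n : ℕ) (hn : 1 ≤ n) :
    ∑ d ∈ Dn n, gg d = 4 / 15 + ∑ a ∈ Finset.range (n + 1), ha a := by
  rw [sum_Dn]
  induction n, hn using Nat.le_induction with
  | base => simp [sum_DD1, Finset.sum_range_succ, ha_zero]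
  | succ n hn ih =>
    rw [Finset.sum_Icc_succ_top (by omega), ih, Finset.sum_range_succ _ (n + 1),
      sum_DD (n + 1) (by omega)]
    ring

lemma ha_bound (a : ℕ) : |ha a| ≤ 24 * ((a : ℝ) ^ 2)⁻¹ := by
  rcases Nat.lt_or_ge a 2 with h | h
  · rw [ha_zero a (by omega), abs_zero]; positivity
  · have h0 : (0 : ℝ) < a := by exact_mod_cast (by omega : 0 < a)
    rw [← sum_DD a h]
    refine (Finset.abs_sum_le_sum_abs _ _).trans ?_
    have : ∀ d ∈ DD a, |gg d| ≤ 2 / (a : ℝ) ^ 3 := fun d hd => by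
      have := gg_bound d
      rwa [(mem_DD.mp hd).1] at this
    refine (Finset.sum_le_sum this).trans ?_
    rw [Finset.sum_const, nsmul_eq_mul]
    have hc : ((DD a).card : ℝ) ≤ 12 * a := by exact_mod_cast DD_card a (by omega)
    calc ((DD a).card : ℝ) * (2 / (a : ℝ) ^ 3) ≤ 12 * a * (2 / (a : ℝ) ^ 3) := by gcongr
      _ = _ := by field_simp; norm_num

lemma ha_summable : Summable ha := by
  refine Summable.of_norm_bounded (g := fun a : ℕ => 24 * ((a : ℝ) ^ 2)⁻¹) ?_ ha_bound
  exact (Real.summable_nat_pow_inv.mpr (by norm_num)).mul_left 24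

lemma tail (n : ℕ) (hn : 1 ≤ n) : |∑ d ∈ Dn n, gg d - gammaConst| ≤ 24 / n := by
  rw [sum_gg n hn, gamma_eq, add_sub_add_left_eq_sub, abs_sub_comm]
  have ht := (ha_summable.hasSum.tendsto_sum_nat.sub_const
    (∑ a ∈ Finset.range (n + 1), ha a)).abs
  refine le_of_tendsto ht ?_
  filter_upwards [Filter.eventually_ge_atTop (n + 1)] with M hM
  rw [← Finset.sum_Ico_eq_sub _ hM]
  refine (Finset.abs_sum_le_sum_abs _ _).trans ((Finset.sum_le_sum fun a _ => ha_bound a).trans ?_)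
  rw [← Finset.mul_sum, div_eq_mul_inv]
  refine mul_le_mul_of_nonneg_left ?_ (by norm_num)
  have h := sum_Ioc_inv_sq_le_sub (α := ℝ) (k := n) (n := M - 1) (by omega) (by omega)
  have e : Finset.Ioc n (M - 1) = Finset.Ico (n + 1) M := by
    ext x; simp only [Finset.mem_Ioc, Finset.mem_Ico]; omega
  rw [e] at h
  have : (0 : ℝ) ≤ ((M - 1 : ℕ) : ℝ)⁻¹ := by positivity
  linarith

lemma main_bound (n : ℕ) (hn : 3 ≤ n) :
    |(trapeziumCount n : ℝ) - gammaConst * (n : ℝ) ^ 5| ≤ 2000 * (n : ℝ) ^ 4 * Real.log n := by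
  have hn' : (3 : ℝ) ≤ n := by exact_mod_cast hn
  have hlog : 1 ≤ Real.log n := by
    rw [Real.le_log_iff_exp_le (by linarith)]
    have := Real.exp_one_lt_d9
    linarith
  obtain ⟨S, hS⟩ : ∃ S, S = ∑ d ∈ Dn n, 1 / (mx d : ℝ) ^ 2 := ⟨_, rfl⟩
  have hS1 : S ≤ 12 * (1 + Real.log n) := hS ▸ sum_inv_sq n
  obtain ⟨X, hX⟩ : ∃ X : ℝ, X = ((∑ d ∈ Dn n, NN n d : ℕ) : ℝ) := ⟨_, rfl⟩
  have lo : X ≤ trapeziumCount n := by rw [hX]; exact_mod_cast count_lower n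
  have up : (trapeziumCount n : ℝ) ≤ X + 2 * (WW n).card := by
    rw [hX]; exact_mod_cast count_upper n
  have hW := WW_card n
  rw [← hS] at hW
  have h1 : |(trapeziumCount n : ℝ) - X| ≤ 50 * (n : ℝ) ^ 4 * S := by
    rw [abs_of_nonneg (by linarith)]; linarith
  have h2 : |X - (∑ d ∈ Dn n, gg d) * (n : ℝ) ^ 5| ≤ 14 * (n : ℝ) ^ 4 * S := by
    rw [hX, hS, Nat.cast_sum, Finset.sum_mul, ← Finset.sum_sub_distrib, Finset.mul_sum]
    refine (Finset.abs_sum_le_sum_abs _ _).trans (Finset.sum_le_sum fun d hd => ?_)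
    obtain ⟨a, b⟩ := mem_Dn.mp hd
    refine (NN_bound n d (mx_pos b) a).trans (le_of_eq (by ring))
  have h3 : |(∑ d ∈ Dn n, gg d) * (n : ℝ) ^ 5 - gammaConst * (n : ℝ) ^ 5| ≤ 24 * (n : ℝ) ^ 4 := by
    rw [← sub_mul, abs_mul, abs_of_nonneg (by positivity : (0 : ℝ) ≤ (n : ℝ) ^ 5)]
    calc _ ≤ 24 / n * (n : ℝ) ^ 5 := mul_le_mul_of_nonneg_right (tail n (by omega)) (by positivity)
      _ = _ := by field_simp
  have t1 := abs_sub_le (trapeziumCount n : ℝ) X (gammaConst * (n : ℝ) ^ 5)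
  have t2 := abs_sub_le X ((∑ d ∈ Dn n, gg d) * (n : ℝ) ^ 5) (gammaConst * (n : ℝ) ^ 5)
  have n4 : (0 : ℝ) < (n : ℝ) ^ 4 := by positivity
  have f1 : (n : ℝ) ^ 4 * S ≤ n ^ 4 * (24 * Real.log n) :=
    mul_le_mul_of_nonneg_left (by linarith) n4.le
  have f2 : (n : ℝ) ^ 4 * 1 ≤ n ^ 4 * Real.log n := mul_le_mul_of_nonneg_left hlog n4.le
  nlinarith

end ITrap

theorem isosceles_trapezia_count :
    ∃ C : ℝ, 0 < C ∧ ∃ N : ℕ, ∀ n ≥ N,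
      |(trapeziumCount n : ℝ) - gammaConst * (n : ℝ) ^ 5| ≤
        C * (n : ℝ) ^ 4 * Real.log n := by
  exact ⟨2000, by norm_num, 3, fun n hn => ITrap.main_bound n hn⟩
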